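/- arXiv:2009.01024 — 2 statements merged into one kernel-verified Lean document; each statement's English description precedes it below -/
import Mathlib

section
/- Let σ be a connected matching, χ = 123132 and χ̄ = 123213. Then the generating function of matchings avoiding the lifting 1(σ+1)1 together with χ and χ̄ satisfies M(1(σ+1)1, χ, χ̄, z) = 1 / (1 - z·F(z)·C(z·F(z)^2)), where F(z) = M(σ, χ, χ̄, z) is the generating function of matchings avoiding σ, χ and χ̄, and C is the Catalan generating function. -/
/-- A (perfect) matching on `Fin m`: a fixed-point-free involution. -/
def IsMatching {m : ℕ} (f : Fin m → Fin m) : Prop :=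
  Function.Involutive f ∧ ∀ i, f i ≠ i

/-- The pattern `σ` occurs in `τ`. -/
def Occurs {m M : ℕ} (σ : Fin m → Fin m) (τ : Fin M → Fin M) : Prop :=
  ∃ g : Fin m → Fin M, StrictMono g ∧ ∀ p, τ (g p) = g (σ p)

def Avoids {m M : ℕ} (σ : Fin m → Fin m) (τ : Fin M → Fin M) : Prop :=
  ¬ Occurs σ τ

def juxt {m M : ℕ} (σ : Fin m → Fin m) (τ : Fin M → Fin M) :
    Fin (m + M) → Fin (m + M) :=
  fun i => finSumFinEquiv (Sum.map σ τ (finSumFinEquiv.symm i))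

def liftMatching {m : ℕ} (σ : Fin m → Fin m) : Fin (m + 2) → Fin (m + 2) := fun i =>
  if _ : i.val = 0 then ⟨m + 1, by omega⟩
  else if _ : i.val = m + 1 then ⟨0, by omega⟩
  else ⟨(σ ⟨i.val - 1, by have := i.isLt; omega⟩).val + 1, by
    have := (σ ⟨i.val - 1, by have := i.isLt; omega⟩).isLt; omega⟩

/-- `τ` contains `σ`, but deleting the rightmost edge of `τ` (the edge containing the
last vertex) destroys every occurrence of `σ`. -/
def MinContains {m M : ℕ} (σ : Fin m → Fin m) (τ : Fin M → Fin M) : Prop :=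
  Occurs σ τ ∧ ¬ ∃ g : Fin m → Fin M, StrictMono g ∧ (∀ p, τ (g p) = g (σ p)) ∧
    ∀ p, (g p : ℕ) ≠ M - 1 ∧ (τ (g p) : ℕ) ≠ M - 1

def ConnectedMatching {m : ℕ} (f : Fin m → Fin m) : Prop :=
  0 < m ∧ ¬ ∃ h : ℕ, 0 < h ∧ h < m ∧ ∀ i : Fin m, ((i : ℕ) < h ↔ ((f i : ℕ) < h))

def HasCrossing {m : ℕ} (f : Fin m → Fin m) : Prop :=
  ∃ a b : Fin m, a < b ∧ b < f a ∧ f a < f b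

def p1122 : Fin 4 → Fin 4 := ![1, 0, 3, 2]
def p1212 : Fin 4 → Fin 4 := ![2, 3, 0, 1]
def p1221 : Fin 4 → Fin 4 := ![3, 2, 1, 0]

def chi : Fin 6 → Fin 6 := ![3, 5, 4, 0, 2, 1]      -- 123132
def chibar : Fin 6 → Fin 6 := ![4, 3, 5, 1, 0, 2]   -- 123213

/-- Partial matchings of the vertices of `ℕ`, the fixed points being left endpoints of pending edges
whose right endpoints lie beyond all vertices and come in the same order, such that the matching
avoids `chi`, `chibar` and the lifting of `σ`. -/
structure Good {m : ℕ} (σ : Fin m → Fin m) (f : ℕ → ℕ) : Prop where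
  invol : Function.Involutive f
  noChi : ∀ a b c, a < b → b < c → c < f a → f a < f c → ¬ (f c < f b ∨ f b = b)
  noChibar : ∀ a b c, a < b → b < c → c < f b →
    ¬ ((f b < f a ∧ (f a < f c ∨ f c = c)) ∨ (f a = a ∧ f c = c))
  noLift : ∀ a (g : Fin m → ℕ), StrictMono g → (∀ p, f (g p) = g (σ p)) →
    ¬ ∀ p, a < g p ∧ (g p < f a ∨ f a = a)

/-- The partial matchings on `[0, N)` with `h` pending edges. -/
def partials {m : ℕ} (σ : Fin m → Fin m) (N h : ℕ) : Set (ℕ → ℕ) :=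
  {f | Good σ f ∧ (∀ i, N ≤ i → f i = i) ∧ {i ∈ Finset.range N | f i = i}.card = h}

/-- The perfect matchings on `[0, N)` avoiding `σ`, `chi` and `chibar`. -/
structure Block {m : ℕ} (σ : Fin m → Fin m) (N : ℕ) (f : ℕ → ℕ) : Prop where
  invol : Function.Involutive f
  supp : ∀ i, N ≤ i → f i = i
  ne : ∀ i, i < N → f i ≠ i
  noChi : ∀ a b c, a < b → b < c → c < f a → f a < f c → ¬ f c < f b
  noChibar : ∀ a b c, a < b → b < c → c < f b → f b < f a → ¬ f a < f c
  noOcc : ∀ g : Fin m → ℕ, StrictMono g → ¬ ∀ p, f (g p) = g (σ p)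

/-- The vertex `x` is pending or belongs to an edge starting before all pending vertices. -/
def Outer (f : ℕ → ℕ) (x : ℕ) : Prop := f x = x ∨ ∀ o, f o = o → f x < o

theorem Function.Involutive.lt_of_fixed_ge {f : ℕ → ℕ} (hf : Function.Involutive f) {N : ℕ}
    (hs : ∀ i, N ≤ i → f i = i) {i : ℕ} (hi : i < N) : f i < N := by
  by_contra! h
  have := hs _ h
  rw [hf i] at this
  omega

/-- Extend a self-map of `Fin M` to `ℕ` by the identity. -/
def extendNat {M : ℕ} (f : Fin M → Fin M) (i : ℕ) : ℕ := if h : i < M then f ⟨i, h⟩ else i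

theorem extendNat_val {M : ℕ} (f : Fin M → Fin M) (i : Fin M) : extendNat f i = f i := by
  simp [extendNat]

theorem extendNat_injective (M : ℕ) : Function.Injective (extendNat (M := M)) := by
  intro f g h
  ext i
  rw [← extendNat_val f, h, extendNat_val]

theorem exists_extendNat {f : ℕ → ℕ} (hf : Function.Involutive f) {N : ℕ}
    (hs : ∀ i, N ≤ i → f i = i) : ∃ f₀ : Fin N → Fin N, extendNat f₀ = f := by
  refine ⟨fun i => ⟨f i, hf.lt_of_fixed_ge hs i.2⟩, ?_⟩
  ext i
  by_cases h : i < N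
  · simp [extendNat, h]
  · simp [extendNat, h, hs i (by omega)]

theorem involutive_extendNat {M : ℕ} {f : Fin M → Fin M} :
    Function.Involutive (extendNat f) ↔ Function.Involutive f := by
  constructor
  · intro h i
    have := h i
    rw [extendNat_val, extendNat_val] at this
    exact Fin.ext this
  · intro h i
    by_cases hi : i < M
    · have := extendNat_val f ⟨i, hi⟩
      simp only at this
      rw [this, extendNat_val, h]
    · simp [extendNat, hi]

theorem extendNat_of_ge {M : ℕ} (f : Fin M → Fin M) {i : ℕ} (hi : M ≤ i) : extendNat f i = i := by
  simp [extendNat, hi]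

theorem extendNat_ne_iff {M : ℕ} {f : Fin M → Fin M} :
    (∀ i, i < M → extendNat f i ≠ i) ↔ ∀ i, f i ≠ i := by
  constructor
  · intro h i hi
    exact h i i.2 (by rw [extendNat_val, hi])
  · intro h i hi hh
    exact h ⟨i, hi⟩ (Fin.ext (by rw [← extendNat_val, hh]))

theorem occurs_iff_extendNat {m M : ℕ} {σ : Fin m → Fin m} (hσ : ∀ i, σ i ≠ i)
    {f : Fin M → Fin M} :
    Occurs σ f ↔ ∃ g : Fin m → ℕ, StrictMono g ∧ ∀ p, extendNat f (g p) = g (σ p) := by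
  constructor
  · rintro ⟨g, hg, h⟩
    refine ⟨fun p => g p, fun a b hab => hg hab, fun p => ?_⟩
    rw [extendNat_val, h]
  · rintro ⟨g, hg, h⟩
    have hlt : ∀ p, g p < M := by
      intro p
      by_contra! hp
      have := h p
      rw [extendNat_of_ge f hp] at this
      exact hσ p (hg.injective this).symm
    refine ⟨fun p => ⟨g p, hlt p⟩, fun a b hab => hg hab, fun p => Fin.ext ?_⟩
    rw [← extendNat_val]
    exact h p

theorem occurs_chi_iff {M : ℕ} {f : Fin M → Fin M} (hf : Function.Involutive f) :
    Occurs chi f ↔ ∃ a b c, a < b ∧ b < c ∧ c < extendNat f a ∧ extendNat f a < extendNat f c ∧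
      extendNat f c < extendNat f b := by
  rw [occurs_iff_extendNat (by decide)]
  have hi := involutive_extendNat.2 hf
  constructor
  · rintro ⟨g, hg, h⟩
    have h0 : extendNat f (g 0) = g 3 := h 0
    have h1 : extendNat f (g 1) = g 5 := h 1
    have h2 : extendNat f (g 2) = g 4 := h 2
    refine ⟨g 0, g 1, g 2, hg (by decide), hg (by decide), ?_⟩
    rw [h0, h1, h2]
    exact ⟨hg (by decide), hg (by decide), hg (by decide)⟩
  · rintro ⟨a, b, c, h1, h2, h3, h4, h5⟩
    refine ⟨![a, b, c, extendNat f a, extendNat f c, extendNat f b], ?_, ?_⟩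
    · rw [Fin.strictMono_iff_lt_succ]
      intro i
      fin_cases i <;> simpa
    · intro p
      fin_cases p <;> simp [chi, hi _]

theorem occurs_chibar_iff {M : ℕ} {f : Fin M → Fin M} (hf : Function.Involutive f) :
    Occurs chibar f ↔ ∃ a b c, a < b ∧ b < c ∧ c < extendNat f b ∧
      extendNat f b < extendNat f a ∧ extendNat f a < extendNat f c := by
  rw [occurs_iff_extendNat (by decide)]
  have hi := involutive_extendNat.2 hf
  constructor
  · rintro ⟨g, hg, h⟩
    have h0 : extendNat f (g 0) = g 4 := h 0
    have h1 : extendNat f (g 1) = g 3 := h 1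
    have h2 : extendNat f (g 2) = g 5 := h 2
    refine ⟨g 0, g 1, g 2, hg (by decide), hg (by decide), ?_⟩
    rw [h0, h1, h2]
    exact ⟨hg (by decide), hg (by decide), hg (by decide)⟩
  · rintro ⟨a, b, c, h1, h2, h3, h4, h5⟩
    refine ⟨![a, b, c, extendNat f b, extendNat f a, extendNat f c], ?_, ?_⟩
    · rw [Fin.strictMono_iff_lt_succ]
      intro i
      fin_cases i <;> simpa
    · intro p
      fin_cases p <;> simp [chibar, hi _]

theorem liftMatching_zero {m : ℕ} (σ : Fin m → Fin m) :
    liftMatching σ 0 = Fin.last (m + 1) := by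
  simp [liftMatching, Fin.ext_iff]

theorem liftMatching_last {m : ℕ} (σ : Fin m → Fin m) :
    liftMatching σ (Fin.last (m + 1)) = 0 := by
  simp [liftMatching]

theorem liftMatching_castSucc_succ {m : ℕ} (σ : Fin m → Fin m) (i : Fin m) :
    liftMatching σ i.succ.castSucc = (σ i).succ.castSucc := by
  have := i.2
  simp [liftMatching, Fin.ext_iff, this.ne]

theorem occurs_liftMatching_iff {m M : ℕ} {σ : Fin m → Fin m} (hm : 0 < m) (hσ : ∀ i, σ i ≠ i)
    {f : Fin M → Fin M} (hf : Function.Involutive f) :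
    Occurs (liftMatching σ) f ↔ ∃ a, ∃ g : Fin m → ℕ, StrictMono g ∧
      (∀ p, extendNat f (g p) = g (σ p)) ∧ ∀ p, a < g p ∧ g p < extendNat f a := by
  have hne : ∀ i, liftMatching σ i ≠ i := by
    intro i
    induction i using Fin.lastCases with
    | last => rw [liftMatching_last]; simp [Fin.ext_iff]
    | cast i =>
      induction i using Fin.cases with
      | zero => simp only [Fin.castSucc_zero, liftMatching_zero]; simp [Fin.ext_iff]
      | succ i => rw [liftMatching_castSucc_succ]; simpa using hσ i
  rw [occurs_iff_extendNat hne]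
  have hi := involutive_extendNat.2 hf
  constructor
  · rintro ⟨g, hg, h⟩
    refine ⟨g 0, fun p => g p.succ.castSucc, fun a b hab => hg (by simpa using hab), fun p => ?_,
      fun p => ⟨hg (by simp [Fin.lt_def]), ?_⟩⟩
    · rw [h, liftMatching_castSucc_succ]
    · rw [h, liftMatching_zero]
      exact hg (Fin.castSucc_lt_last _)
  · rintro ⟨a, g, hg, h, hin⟩
    refine ⟨Fin.snoc (Fin.cons a g : Fin (m + 1) → ℕ) (extendNat f a), ?_, fun p => ?_⟩
    · intro i j hij
      have ha : a < extendNat f a := (hin ⟨0, hm⟩).1.trans (hin ⟨0, hm⟩).2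
      induction j using Fin.lastCases with
      | last =>
        induction i using Fin.lastCases with
        | last => exact absurd hij (lt_irrefl _)
        | cast i =>
          simp only [Fin.snoc_last, Fin.snoc_castSucc]
          induction i using Fin.cases with
          | zero => simpa using ha
          | succ i => simpa using (hin i).2
      | cast j =>
        induction i using Fin.lastCases with
        | last => exact absurd (hij.trans (Fin.castSucc_lt_last _)) (lt_irrefl _)
        | cast i =>
          simp only [Fin.snoc_castSucc]
          induction j using Fin.cases with
          | zero => simp at hij
          | succ j =>
            induction i using Fin.cases with
            | zero => simpa using (hin j).1
            | succ i => simpa using hg (by simpa using hij)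
    · induction p using Fin.lastCases with
      | last =>
        rw [liftMatching_last, ← Fin.castSucc_zero, Fin.snoc_castSucc]
        simp [hi _]
      | cast p =>
        induction p using Fin.cases with
        | zero =>
          simp only [Fin.castSucc_zero, liftMatching_zero]
          rw [← Fin.castSucc_zero, Fin.snoc_castSucc]
          simp
        | succ p => rw [liftMatching_castSucc_succ]; simp only [Fin.snoc_castSucc]; simpa using h p

theorem extendNat_image_eq_block {m : ℕ} {σ : Fin m → Fin m} (hσ : ∀ i, σ i ≠ i) (M : ℕ) :
    extendNat '' {f : Fin M → Fin M |
      IsMatching f ∧ Avoids σ f ∧ Avoids chi f ∧ Avoids chibar f} = {f | Block σ M f} := by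
  ext f
  constructor
  · rintro ⟨f, ⟨⟨hi, hne⟩, h1, h2, h3⟩, rfl⟩
    rw [Avoids, occurs_iff_extendNat hσ] at h1
    rw [Avoids, occurs_chi_iff hi] at h2
    rw [Avoids, occurs_chibar_iff hi] at h3
    push Not at h1 h2 h3
    refine ⟨involutive_extendNat.2 hi, fun i => extendNat_of_ge f, extendNat_ne_iff.2 hne,
      fun a b c h h' h'' h''' => not_lt.2 (h2 a b c h h' h'' h'''),
      fun a b c h h' h'' h''' => not_lt.2 (h3 a b c h h' h'' h'''), fun g hg hh => ?_⟩
    obtain ⟨p, hp⟩ := h1 g hg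
    exact hp (hh p)
  · intro h
    obtain ⟨f, rfl⟩ := exists_extendNat h.invol h.supp
    have hi := involutive_extendNat.1 h.invol
    refine ⟨f, ⟨⟨hi, extendNat_ne_iff.1 h.ne⟩, ?_, ?_, ?_⟩, rfl⟩
    · rw [Avoids, occurs_iff_extendNat hσ]
      rintro ⟨g, hg, hh⟩
      exact h.noOcc g hg hh
    · rw [Avoids, occurs_chi_iff hi]
      rintro ⟨a, b, c, h1, h2, h3, h4, h5⟩
      exact h.noChi a b c h1 h2 h3 h4 h5
    · rw [Avoids, occurs_chibar_iff hi]
      rintro ⟨a, b, c, h1, h2, h3, h4, h5⟩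
      exact h.noChibar a b c h1 h2 h3 h4 h5

theorem card_range_filter_fixed_eq_zero {f : ℕ → ℕ} {N : ℕ} :
    {i ∈ Finset.range N | f i = i}.card = 0 ↔ ∀ i, i < N → f i ≠ i := by
  simp [Finset.filter_eq_empty_iff]

theorem extendNat_image_eq_partials {m : ℕ} {σ : Fin m → Fin m} (hm : 0 < m)
    (hσ : ∀ i, σ i ≠ i) (M : ℕ) :
    extendNat '' {f : Fin M → Fin M |
      IsMatching f ∧ Avoids (liftMatching σ) f ∧ Avoids chi f ∧ Avoids chibar f} =
      partials σ M 0 := by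
  ext f
  constructor
  · rintro ⟨f, ⟨⟨hi, hne⟩, h1, h2, h3⟩, rfl⟩
    rw [Avoids, occurs_liftMatching_iff hm hσ hi] at h1
    rw [Avoids, occurs_chi_iff hi] at h2
    rw [Avoids, occurs_chibar_iff hi] at h3
    have hI := involutive_extendNat.2 hi
    have hs := fun i => extendNat_of_ge f (i := i)
    have hlt := fun i => hI.lt_of_fixed_ge hs (i := i)
    have hne' := extendNat_ne_iff.2 hne
    push Not at h2 h3
    refine ⟨⟨hI, ?_, ?_, ?_⟩, hs, card_range_filter_fixed_eq_zero.2 hne'⟩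
    · intro a b c hab hbc hca hac
      have := h2 a b c hab hbc hca hac
      grind
    · intro a b c hab hbc hcb
      have := h3 a b c hab hbc hcb
      grind
    · intro a g hg hh hin
      have h0 : ∀ p, g p < M := by
        intro p
        by_contra! hp
        have := hh p
        rw [hs _ hp] at this
        exact hσ p (hg.injective this).symm
      refine h1 ⟨a, g, hg, hh, fun p => ⟨(hin p).1, ?_⟩⟩
      rcases (hin p).2 with h | h
      · exact h
      · exact absurd h (hne' _ ((hin p).1.trans (h0 p)))
  · rintro ⟨h, hs, hc⟩
    obtain ⟨f, rfl⟩ := exists_extendNat h.invol hs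
    have hi := involutive_extendNat.1 h.invol
    refine ⟨f, ⟨⟨hi, extendNat_ne_iff.1 (card_range_filter_fixed_eq_zero.1 hc)⟩, ?_, ?_, ?_⟩, rfl⟩
    · rw [Avoids, occurs_liftMatching_iff hm hσ hi]
      rintro ⟨a, g, hg, hh, hin⟩
      exact h.noLift a g hg hh fun p => ⟨(hin p).1, Or.inl (hin p).2⟩
    · rw [Avoids, occurs_chi_iff hi]
      rintro ⟨a, b, c, h1, h2, h3, h4, h5⟩
      exact h.noChi a b c h1 h2 h3 h4 (Or.inl h5)
    · rw [Avoids, occurs_chibar_iff hi]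
      rintro ⟨a, b, c, h1, h2, h3, h4, h5⟩
      exact h.noChibar a b c h1 h2 h3 (Or.inl ⟨h4, Or.inl h5⟩)

theorem finite_involutive_supported (N : ℕ) :
    {f : ℕ → ℕ | Function.Involutive f ∧ ∀ i, N ≤ i → f i = i}.Finite :=
  (Set.finite_range (extendNat (M := N))).subset fun _ hf => exists_extendNat hf.1 hf.2

theorem finite_partials {m : ℕ} (σ : Fin m → Fin m) (N h : ℕ) : (partials σ N h).Finite :=
  (finite_involutive_supported N).subset fun _ hf => ⟨hf.1.invol, hf.2.1⟩

theorem finite_block {m : ℕ} (σ : Fin m → Fin m) (N : ℕ) : {f | Block σ N f}.Finite :=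
  (finite_involutive_supported N).subset fun _ hf => ⟨hf.invol, hf.supp⟩

theorem ncard_block_of_odd {m : ℕ} (σ : Fin m → Fin m) {N : ℕ} (hN : ¬ 2 ∣ N) :
    {f | Block σ N f}.ncard = 0 := by
  rw [Set.ncard_eq_zero (finite_block σ N), Set.eq_empty_iff_forall_notMem]
  intro f hf
  apply hN
  rw [← ZMod.natCast_eq_zero_iff]
  have := Finset.sum_involution (s := Finset.range N) (f := fun _ => (1 : ZMod 2))
    (fun i _ => f i) (fun _ _ => by decide) (fun i hi _ => hf.ne i (Finset.mem_range.1 hi))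
    (fun i hi => Finset.mem_range.2 (hf.invol.lt_of_fixed_ge hf.supp (Finset.mem_range.1 hi)))
    (fun i _ => hf.invol i)
  simpa using this

theorem good_id {m : ℕ} {σ : Fin m → Fin m} (hm : 0 < m) (hσ : ∀ i, σ i ≠ i) : Good σ id where
  invol := fun _ => rfl
  noChi := by intro a b c; simp only [id]; omega
  noChibar := by intro a b c; simp only [id]; omega
  noLift := fun _ _ hg hh _ => hσ ⟨0, hm⟩ (hg.injective (hh ⟨0, hm⟩)).symm

theorem ncard_partials_zero_zero {m : ℕ} {σ : Fin m → Fin m} (hm : 0 < m) (hσ : ∀ i, σ i ≠ i) :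
    (partials σ 0 0).ncard = 1 := by
  rw [Set.ncard_eq_one]
  refine ⟨id, Set.eq_singleton_iff_unique_mem.2 ⟨⟨good_id hm hσ, fun _ _ => rfl, by simp⟩, ?_⟩⟩
  intro f hf
  ext i
  exact hf.2.1 i (Nat.zero_le i)

theorem ncard_partials_zero_succ {m : ℕ} (σ : Fin m → Fin m) (h : ℕ) :
    (partials σ 0 (h + 1)).ncard = 0 := by
  rw [Set.ncard_eq_zero (finite_partials σ 0 _), Set.eq_empty_iff_forall_notMem]
  intro f hf
  simpa using hf.2.2

/-- Partial matchings whose last vertex is pending. -/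
theorem partials_inter_pending {m : ℕ} (σ : Fin m → Fin m) (N h : ℕ) :
    {f ∈ partials σ (N + 1) (h + 1) | f N = N} = partials σ N h := by
  ext f
  simp only [partials, Set.mem_ofPred_eq, Finset.range_add_one, Finset.filter_insert]
  constructor
  · rintro ⟨⟨hg, hs, hc⟩, hN⟩
    rw [if_pos hN, Finset.card_insert_of_notMem (by simp)] at hc
    refine ⟨hg, fun i hi => ?_, by omega⟩
    rcases hi.eq_or_lt with rfl | hi
    · exact hN
    · exact hs i hi
  · rintro ⟨hg, hs, hc⟩
    refine ⟨⟨hg, fun i hi => hs i (by omega), ?_⟩, hs N le_rfl⟩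
    rw [if_pos (hs N le_rfl), Finset.card_insert_of_notMem (by simp), hc]

/-- Remove the edge through `N`, keeping its endpoints as fixed points. -/
def cutAt (N : ℕ) (f : ℕ → ℕ) (i : ℕ) : ℕ := if i = N ∨ f i = N then i else f i

/-- Join the fixed points `c` and `N` by an edge. -/
def joinAt (c N : ℕ) (f : ℕ → ℕ) (i : ℕ) : ℕ := if i = c then N else if i = N then c else f i

theorem joinAt_cutAt {f : ℕ → ℕ} (hf : Function.Involutive f) (N : ℕ) :
    joinAt (f N) N (cutAt N f) = f := by
  ext i
  have := hf i
  have := hf N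
  unfold joinAt cutAt
  grind

theorem cutAt_joinAt {f : ℕ → ℕ} (hf : Function.Involutive f) {c N : ℕ} (hc : f c = c)
    (hN : f N = N) : cutAt N (joinAt c N f) = f := by
  ext i
  have := hf i
  unfold joinAt cutAt
  grind

theorem involutive_joinAt {f : ℕ → ℕ} (hf : Function.Involutive f) {c N : ℕ} (hc : f c = c)
    (hN : f N = N) : Function.Involutive (joinAt c N f) := by
  intro i
  have := hf i
  unfold joinAt
  grind

theorem good_joinAt_iff {m : ℕ} {σ : Fin m → Fin m} (hσ : ∀ i, σ i ≠ i)
    {f : ℕ → ℕ} (hf : Function.Involutive f) {c N : ℕ} (hcN : c < N) (hc : f c = c)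
    (hs : ∀ i, N ≤ i → f i = i) (hmin : ∀ o, f o = o → c ≤ o) :
    Good σ (joinAt c N f) ↔ Good σ f := by
  have hN := hs N le_rfl
  have hlt : ∀ i, i < N → f i < N := fun i => hf.lt_of_fixed_ge hs
  have hjc : joinAt c N f c = N := by simp [joinAt]
  have hjN : joinAt c N f N = c := by simp [joinAt, hcN.ne']
  have hj : ∀ i, i ≠ c → i ≠ N → joinAt c N f i = f i := by
    intro i h1 h2; simp [joinAt, h1, h2]
  have hgt : ∀ i, N < i → joinAt c N f i = i := by
    intro i h; rw [hj i (by omega) (by omega), hs i h.le]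
  have hinv := involutive_joinAt hf hc hN
  generalize joinAt c N f = k at *
  have hfc : ∀ i, f i = c → i = c := fun i h => by rw [← hf i, h, hc]
  have hfN : ∀ i, f i = N → i = N := fun i h => by rw [← hf i, h, hN]
  have hsN : ∀ i, N ≤ i → f i = i := hs
  have hle : ∀ i, i < k i → k i ≤ N := by
    intro i h
    by_contra! h'
    have := hinv i
    rw [hgt _ h'] at this
    omega
  constructor
  · intro hk
    refine ⟨hf, ?_, ?_, ?_⟩
    · intro a b d h1 h2 h3 h4
      have := hk.noChi a b d h1 h2
      have := hlt d
      have := hsN a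
      have := hsN d
      have := hj a
      have := hj b
      have := hj d
      grind
    · intro a b d h1 h2 h3
      have := hk.noChibar a b d h1 h2
      have := hlt b
      have := hlt a
      have := hsN a
      have := hsN b
      have := hsN d
      have := hj a
      have := hj b
      have := hj d
      have := hmin a
      have := hmin d
      grind
    · intro a g hg hh hin
      have hne : ∀ p, f (g p) ≠ g p := fun p h => hσ p (hg.injective (by rw [← hh p, h]))
      have hgN : ∀ p, g p < N := by
        intro p
        by_contra! h
        exact hne p (hs _ h)
      refine hk.noLift a g hg (fun p => ?_) (fun p => ⟨(hin p).1, ?_⟩)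
      · rw [← hh p]
        exact hj _ (fun h => hne p (by rw [h, hc])) (hgN p).ne
      · have h1 := hin p
        have h2 := hgN p
        by_cases hac : a = c
        · left
          rw [hac, hjc]
          exact h2
        · rw [hj a hac (by omega)]
          exact h1.2
  · intro hk
    refine ⟨hinv, ?_, ?_, ?_⟩
    · intro a b d h1 h2 h3 h4
      have := hk.noChi a b d h1 h2
      have := hle a
      have := hle b
      have := hle d
      have := hj a
      have := hj b
      have := hj d
      have := hmin b
      grind
    · intro a b d h1 h2 h3
      have := hk.noChibar a b d h1 h2
      have := hle a
      have := hle b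
      have := hle d
      have := hj a
      have := hj b
      have := hj d
      have := hmin a
      grind
    · intro a g hg hh hin
      have hnc : ∀ p, g p ≠ c := by
        intro p hp
        have h1 := hh p
        rw [hp, hjc] at h1
        have h2 := hin p
        have h3 := hin (σ p)
        rw [← h1] at h3
        have := hle a
        have := hj a
        have := hmin a
        grind
      have hnN : ∀ p, g p ≠ N := by
        intro p hp
        have h1 := hh p
        rw [hp, hjN] at h1
        exact hnc _ h1.symm
      refine hk.noLift a g hg (fun p => ?_) (fun p => ⟨(hin p).1, ?_⟩)
      · rw [← hh p, hj _ (hnc p) (hnN p)]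
      · have h1 := hin p
        have := hj a
        grind

theorem mem_partials_cutAt {m : ℕ} {σ : Fin m → Fin m} (hσ : ∀ i, σ i ≠ i)
    {N h : ℕ} {f : ℕ → ℕ} (hf : f ∈ partials σ (N + 1) h) (hN : ∀ o, f o = o → f N < o) :
    cutAt N f ∈ partials σ N (h + 1) ∧ cutAt N f (f N) = f N ∧ f N < N ∧
      ∀ o, cutAt N f o = o → f N ≤ o := by
  obtain ⟨hg, hs, hc⟩ := hf
  have hi := hg.invol
  have hle : f N < N := by
    have h1 : f N < N + 1 := hi.lt_of_fixed_ge hs (by omega)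
    have h2 : f N ≠ N := fun h => absurd (hN N h) (by omega)
    omega
  have hcN : cutAt N f N = N := by simp [cutAt]
  have hcc : cutAt N f (f N) = f N := by simp [cutAt, hi N]
  have hinv : Function.Involutive (cutAt N f) := by
    intro i
    have := hi i
    have := hi N
    unfold cutAt
    grind
  have hs' : ∀ i, N ≤ i → cutAt N f i = i := by
    intro i h
    rcases h.eq_or_lt with rfl | h
    · exact hcN
    · simp [cutAt, hs i h]
  have hmin : ∀ o, cutAt N f o = o → f N ≤ o := by
    intro o ho
    have := hi o
    have := hN o
    unfold cutAt at ho
    grind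
  refine ⟨⟨?_, hs', ?_⟩, hcc, hle, hmin⟩
  · rw [← good_joinAt_iff hσ hinv hle hcc hs' hmin, joinAt_cutAt hi]
    exact hg
  · have : {i ∈ Finset.range N | cutAt N f i = i} =
        insert (f N) {i ∈ Finset.range (N + 1) | f i = i} := by
      ext i
      have := hi i
      have := hi N
      simp only [Finset.mem_filter, Finset.mem_range, Finset.mem_insert, cutAt]
      grind
    rw [this, Finset.card_insert_of_notMem, hc]
    simp [hi N, hle.ne']

theorem ncard_partials_closed {m : ℕ} {σ : Fin m → Fin m} (hσ : ∀ i, σ i ≠ i)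
    (N h : ℕ) :
    {f ∈ partials σ (N + 1) h | ∀ o, f o = o → f N < o}.ncard =
      (partials σ N (h + 1)).ncard := by
  have hinj : Set.InjOn (cutAt N) {f ∈ partials σ (N + 1) h | ∀ o, f o = o → f N < o} := by
    rintro f ⟨hf, hfo⟩ g ⟨hg, hgo⟩ heq
    obtain ⟨-, h1, -, h2⟩ := mem_partials_cutAt hσ hf hfo
    obtain ⟨-, h3, -, h4⟩ := mem_partials_cutAt hσ hg hgo
    rw [← joinAt_cutAt hf.1.invol N, ← joinAt_cutAt hg.1.invol N, heq]
    rw [heq] at h1 h2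
    rw [le_antisymm (h2 _ h3) (h4 _ h1)]
  rw [← hinj.ncard_image]
  congr 1
  ext f
  constructor
  · rintro ⟨f, ⟨hf, hfo⟩, rfl⟩
    exact (mem_partials_cutAt hσ hf hfo).1
  · rintro ⟨hg, hs, hc⟩
    have hex : ∃ i, i < N ∧ f i = i := by
      have : 0 < {i ∈ Finset.range N | f i = i}.card := by omega
      obtain ⟨i, hi⟩ := Finset.card_pos.1 this
      exact ⟨i, by simpa using hi⟩
    classical
    obtain ⟨hcN, hcc⟩ := Nat.find_spec hex
    have hmin : ∀ o, f o = o → Nat.find hex ≤ o := by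
      intro o ho
      by_contra! hlt
      exact Nat.find_min hex hlt ⟨by omega, ho⟩
    generalize Nat.find hex = c at *
    have hN := hs N le_rfl
    have hi := hg.invol
    have hjN : joinAt c N f N = c := by simp [joinAt, hcN.ne']
    refine ⟨joinAt c N f, ⟨⟨(good_joinAt_iff hσ hi hcN hcc hs hmin).2 hg, ?_, ?_⟩, ?_⟩,
      cutAt_joinAt hi hcc hN⟩
    · intro i h
      have := hs i
      unfold joinAt
      grind
    · have : {i ∈ Finset.range (N + 1) | joinAt c N f i = i} =
          {i ∈ Finset.range N | f i = i}.erase c := by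
        ext i
        simp only [Finset.mem_filter, Finset.mem_range, Finset.mem_erase, joinAt]
        grind
      rw [this, Finset.card_erase_of_mem (by simp [hcN, hcc]), hc]
      rfl
    · intro o ho
      rw [hjN]
      have := hmin o
      unfold joinAt at ho
      grind

theorem ncard_partials_succ_zero {m : ℕ} {σ : Fin m → Fin m} (hσ : ∀ i, σ i ≠ i)
    (N : ℕ) : (partials σ (N + 1) 0).ncard = (partials σ N 1).ncard := by
  rw [← ncard_partials_closed hσ]
  congr 1
  ext f
  refine ⟨fun hf => ⟨hf, fun o ho => ?_⟩, fun hf => hf.1⟩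
  have h1 := card_range_filter_fixed_eq_zero.1 hf.2.2
  have h2 := hf.1.invol.lt_of_fixed_ge hf.2.1 (Nat.lt_succ_self N)
  by_contra! h
  exact h1 o (by omega) ho

theorem ncard_partials_outer {m : ℕ} {σ : Fin m → Fin m} (hσ : ∀ i, σ i ≠ i)
    (N h : ℕ) : {f ∈ partials σ (N + 1) (h + 1) | Outer f N}.ncard =
      (partials σ N h).ncard + (partials σ N (h + 2)).ncard := by
  rw [← ncard_partials_closed hσ N (h + 1), ← partials_inter_pending σ N h, ← Set.ncard_union_eq ?_
    ((finite_partials σ _ _).subset fun f hf => hf.1)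
    ((finite_partials σ _ _).subset fun f hf => hf.1)]
  · congr 1
    ext f
    simp only [Outer, Set.mem_ofPred_eq, Set.mem_union]
    tauto
  · rw [Set.disjoint_left]
    rintro f ⟨-, h1⟩ ⟨-, h2⟩
    exact absurd (h2 N h1) (by omega)

theorem ConnectedMatching.forall_le_or_forall_lt {m : ℕ} {σ : Fin m → Fin m}
    (hconn : ConnectedMatching σ) {f : ℕ → ℕ} {x : ℕ} (hx : ∀ i, f i ≤ x ↔ i ≤ x)
    {g : Fin m → ℕ} (hg : StrictMono g) (hh : ∀ p, f (g p) = g (σ p)) :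
    (∀ p, g p ≤ x) ∨ ∀ p, x < g p := by
  classical
  by_contra! hcon
  obtain ⟨⟨j, hj⟩, ⟨i, hi⟩⟩ := hcon
  have hex : ∃ n, ∃ hn : n < m, x < g ⟨n, hn⟩ := ⟨j, j.2, hj⟩
  have key : ∀ q : Fin m, (q : ℕ) < Nat.find hex ↔ g q ≤ x := by
    intro q
    constructor
    · intro hq
      by_contra! hlt
      exact Nat.find_min hex hq ⟨q.2, hlt⟩
    · intro hq
      by_contra! hlt
      obtain ⟨hn, hlt'⟩ := Nat.find_spec hex
      have : g ⟨Nat.find hex, hn⟩ ≤ g q := hg.monotone hlt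
      omega
  refine hconn.2 ⟨Nat.find hex, ?_, ?_, fun q => ?_⟩
  · have := (key i).2 hi
    omega
  · exact (Nat.find_spec hex).1
  · rw [key, key, ← hh, hx]

/-- Place `g` to the right of the vertex `x`, keeping `f` on the vertices up to `x`. -/
def glue (x : ℕ) (f g : ℕ → ℕ) (i : ℕ) : ℕ := if i ≤ x then f i else g (i - (x + 1)) + (x + 1)

section glue

variable {m : ℕ} {σ : Fin m → Fin m} {x L h : ℕ} {f g : ℕ → ℕ}

theorem glue_of_le {i : ℕ} (hi : i ≤ x) : glue x f g i = f i := by simp [glue, hi]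

theorem glue_add (i : ℕ) : glue x f g (i + (x + 1)) = g i + (x + 1) := by
  simp [glue, show ¬ i + (x + 1) ≤ x by omega]

theorem glue_mem_partials (hconn : ConnectedMatching σ)
    (hf : f ∈ partials σ (x + 1) (h + 1)) (hg : Block σ L g) :
    glue x f g ∈ partials σ (x + L + 1) (h + 1) := by
  obtain ⟨hG, hs, hc⟩ := hf
  have hfx : ∀ i, i ≤ x → f i ≤ x := fun i hi =>
    Nat.lt_succ_iff.1 (hG.invol.lt_of_fixed_ge hs (Nat.lt_succ_iff.2 hi))
  have hle : ∀ i, i ≤ x → glue x f g i = f i := fun i => glue_of_le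
  have hadd : ∀ i, glue x f g (i + (x + 1)) = g i + (x + 1) := glue_add
  have hex : ∀ i, x < i → ∃ j, i = j + (x + 1) := fun i hi => ⟨i - (x + 1), by omega⟩
  have hbig : ∀ i, x + L + 1 ≤ i → glue x f g i = i := by
    intro i hi
    obtain ⟨j, rfl⟩ := hex i (by omega)
    rw [hadd, hg.supp j (by omega)]
  have hfix : ∀ i, glue x f g i = i → i < x + L + 1 → i ≤ x := by
    intro i hi hlt
    by_contra! hxi
    obtain ⟨j, rfl⟩ := hex i hxi
    rw [hadd] at hi
    exact hg.ne j (by omega) (by omega)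
  have hinv : Function.Involutive (glue x f g) := by
    intro i
    by_cases hi : i ≤ x
    · rw [hle i hi, hle _ (hfx i hi), hG.invol]
    · obtain ⟨j, rfl⟩ := hex i (by omega)
      rw [hadd, hadd, hg.invol]
  have hltN : ∀ i, i < x + L + 1 → glue x f g i < x + L + 1 :=
    fun i => hinv.lt_of_fixed_ge hbig
  have hiff : ∀ i, glue x f g i ≤ x ↔ i ≤ x := by
    intro i
    by_cases hi : i ≤ x
    · simp [hle i hi, hfx i hi, hi]
    · obtain ⟨j, rfl⟩ := hex i (by omega)
      rw [hadd]
      omega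
  have hcard : {i ∈ Finset.range (x + L + 1) | glue x f g i = i} =
      {i ∈ Finset.range (x + 1) | f i = i} := by
    ext i
    simp only [Finset.mem_filter, Finset.mem_range]
    constructor
    · rintro ⟨h1, h2⟩
      have := hfix i h2 h1
      rw [hle i this] at h2
      exact ⟨by omega, h2⟩
    · rintro ⟨h1, h2⟩
      exact ⟨by omega, by rw [hle i (by omega), h2]⟩
  refine ⟨⟨hinv, ?_, ?_, ?_⟩, hbig, by rw [hcard, hc]⟩
  · intro a b c h1 h2 h3 h4 h5
    by_cases ha : a ≤ x
    · have hka := (hiff a).2 ha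
      have := hG.noChi a b c h1 h2
      have := hle a ha
      have := hle b (by omega)
      have := hle c (by omega)
      grind
    · obtain ⟨a, rfl⟩ := hex a (by omega)
      obtain ⟨b, rfl⟩ := hex b (by omega)
      obtain ⟨c, rfl⟩ := hex c (by omega)
      have := hg.noChi a b c
      have := hfix (b + (x + 1))
      have := hbig (a + (x + 1))
      have := hltN (a + (x + 1))
      grind
  · intro a b c h1 h2 h3 h5
    by_cases hb : b ≤ x
    · have hkb := (hiff b).2 hb
      have := hG.noChibar a b c h1 h2
      have := hle a (by omega)
      have := hle b hb
      have := hle c (by omega)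
      grind
    · have hcn : glue x f g c ≠ c := by
        intro hc
        have := hfix c hc
        have := hltN b
        have := hbig b
        grind
      have ha : x < a := by
        have := hiff a
        have := hiff b
        have := hiff c
        by_contra! hax
        grind
      obtain ⟨a, rfl⟩ := hex a (by omega)
      obtain ⟨b, rfl⟩ := hex b (by omega)
      obtain ⟨c, rfl⟩ := hex c (by omega)
      have := hg.noChibar a b c
      grind
  · intro a k hk hh hin
    have hfk : (∀ p, x < k p) → False := by
      intro hlt
      refine hg.noOcc (fun p => k p - (x + 1)) (fun p q hpq => ?_) (fun p => ?_)
      · have := hk hpq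
        have := hlt p
        have := hlt q
        simp only
        omega
      · have h1 := hh p
        obtain ⟨j, hj⟩ := hex (k p) (hlt p)
        rw [hj, hadd] at h1
        rw [hj, ← h1]
        simp
    rcases hconn.forall_le_or_forall_lt hiff hk hh with hall | hall
    · refine hG.noLift a k hk (fun p => by rw [← hh, hle _ (hall p)]) fun p => ?_
      have h1 := hin p
      have h2 := hall p
      rw [hle a (by omega)] at h1
      exact h1
    · exact hfk hall

theorem outer_glue (hf : f ∈ partials σ (x + 1) (h + 1)) (ho : Outer f x) :
    Outer (glue x f g) x := by
  obtain ⟨hG, hs, hc⟩ := hf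
  have hfx := hG.invol.lt_of_fixed_ge hs (Nat.lt_succ_self x)
  rcases ho with ho | ho
  · left
    rw [glue_of_le le_rfl, ho]
  · right
    intro o hoo
    rw [glue_of_le le_rfl]
    by_cases hox : o ≤ x
    · rw [glue_of_le hox] at hoo
      exact ho o hoo
    · omega

theorem not_outer_glue (hf : f ∈ partials σ (x + 1) (h + 1)) (hg : Block σ L g) {y : ℕ}
    (hxy : x < y) (hy : y < x + L + 1) : ¬ Outer (glue x f g) y := by
  obtain ⟨hG, hs, hc⟩ := hf
  obtain ⟨j, rfl⟩ : ∃ j, y = j + (x + 1) := ⟨y - (x + 1), by omega⟩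
  have : 0 < {i ∈ Finset.range (x + 1) | f i = i}.card := by omega
  obtain ⟨o, ho⟩ := Finset.card_pos.1 this
  simp only [Finset.mem_filter, Finset.mem_range] at ho
  rintro (h1 | h1)
  · rw [glue_add] at h1
    exact hg.ne j (by omega) (by omega)
  · have := h1 o (by rw [glue_of_le (by omega), ho.2])
    rw [glue_add] at this
    omega

theorem exists_glue_eq {N : ℕ} (hσ : ∀ i, σ i ≠ i)
    (hf : f ∈ partials σ (N + 1) (h + 1)) :
    ∃ x L, x + L = N ∧ ∃ f' ∈ partials σ (x + 1) (h + 1), Outer f' x ∧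
      ∃ g, Block σ L g ∧ glue x f' g = f := by
  obtain ⟨hG, hs, hc⟩ := hf
  have hinv := hG.invol
  have hpos : 0 < {i ∈ Finset.range (N + 1) | f i = i}.card := by omega
  obtain ⟨o, ho⟩ := Finset.card_pos.1 hpos
  simp only [Finset.mem_filter, Finset.mem_range] at ho
  classical
  obtain ⟨x, hxN, hx, hmax⟩ : ∃ x, x ≤ N ∧ Outer f x ∧ ∀ y, x < y → y ≤ N → ¬ Outer f y :=
    ⟨Nat.findGreatest (Outer f) N, Nat.findGreatest_le N,
      Nat.findGreatest_spec (m := o) (by omega) (Or.inl ho.2),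
      fun y h1 h2 => Nat.findGreatest_is_greatest h1 h2⟩
  have hox : o ≤ x := by
    by_contra! hlt
    exact hmax o hlt (by omega) (Or.inl ho.2)
  have hclosed : ∀ y, x < y → x < f y := by
    intro y hxy
    by_cases hyN : y ≤ N
    · have hno := hmax y hxy hyN
      have h2 := hinv x
      have h3 := hinv y
      unfold Outer at hno hx
      push Not at hno
      obtain ⟨hne, o', ho', hle⟩ := hno
      have h1 := hG.noChi (f x) o' (f y)
      have h4 := hG.noChibar o' (f y) x
      by_contra! hcon
      grind
    · rw [hs y (by omega)]
      exact hxy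
  have hle : ∀ y, y ≤ x → f y ≤ x := by
    intro y hy
    by_contra! hlt
    have := hclosed _ hlt
    rw [hinv] at this
    omega
  have hnefix : ∀ y, x < y → y ≤ N → f y ≠ y := fun y h1 h2 h3 => hmax y h1 h2 (Or.inl h3)
  obtain ⟨f', hf'⟩ : ∃ f' : ℕ → ℕ, f' = fun i => if i ≤ x then f i else i := ⟨_, rfl⟩
  obtain ⟨g, hg⟩ : ∃ g : ℕ → ℕ, g = fun i => f (i + (x + 1)) - (x + 1) := ⟨_, rfl⟩
  have hf1 : ∀ i, i ≤ x → f' i = f i := fun i hi => by simp [hf', hi]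
  have hf2 : ∀ i, x < i → f' i = i := fun i hi => by simp [hf', not_le.2 hi]
  have hg1 : ∀ i, f (i + (x + 1)) = g i + (x + 1) := by
    intro i
    have := hclosed (i + (x + 1)) (by omega)
    rw [hg]
    simp only
    omega
  clear hf' hg
  refine ⟨x, N - x, by omega, f', ⟨⟨?_, ?_, ?_, ?_⟩, fun i hi => hf2 i hi, ?_⟩, ?_, g,
    ⟨?_, ?_, ?_, ?_, ?_, ?_⟩, ?_⟩
  · intro i
    by_cases hi : i ≤ x
    · rw [hf1 i hi, hf1 _ (hle i hi), hinv]
    · rw [hf2 i (by omega), hf2 i (by omega)]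
  · intro a b c h1 h2 h3 h4
    have := hG.noChi a b c h1 h2
    have := hf1 a
    have := hf1 b
    have := hf1 c
    have := hf2 a
    have := hf2 b
    have := hf2 c
    have := hle a
    grind
  · intro a b c h1 h2 h3
    have := hG.noChibar a b c h1 h2
    have := hf1 a
    have := hf1 b
    have := hf1 c
    have := hf2 a
    have := hf2 b
    have := hf2 c
    have := hle b
    grind
  · intro a k hk hh hin
    have hkx : ∀ p, k p ≤ x := by
      intro p
      by_contra! hlt
      have := hh p
      rw [hf2 _ hlt] at this
      exact hσ p (hk.injective this).symm
    refine hG.noLift a k hk (fun p => by rw [← hh, hf1 _ (hkx p)]) fun p => ?_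
    have h1 := hin p
    have h2 := hkx p
    rw [hf1 a (by omega)] at h1
    exact h1
  · rw [← hc]
    congr 1
    ext i
    simp only [Finset.mem_filter, Finset.mem_range]
    have := hf1 i
    have := hnefix i
    grind
  · rcases hx with hx | hx
    · left
      rw [hf1 x le_rfl, hx]
    · right
      intro o ho
      have := hx o
      have := hf1 o
      have := hf1 x le_rfl
      have := hle x le_rfl
      grind
  · intro i
    have := hinv (i + (x + 1))
    rw [hg1, hg1] at this
    omega
  · intro i hi
    have := hg1 i
    rw [hs _ (by omega)] at this
    omega
  · intro i hi
    have := hnefix (i + (x + 1)) (by omega) (by omega)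
    rw [hg1] at this
    omega
  · intro a b c h1 h2 h3 h4 h5
    refine hG.noChi (a + (x + 1)) (b + (x + 1)) (c + (x + 1)) (by omega) (by omega) ?_ ?_ ?_ <;>
    simp only [hg1] <;> omega
  · intro a b c h1 h2 h3 h4 h5
    refine hG.noChibar (a + (x + 1)) (b + (x + 1)) (c + (x + 1)) (by omega) (by omega) ?_ ?_ <;>
    simp only [hg1] <;> omega
  · intro k hk hh
    refine hG.noLift o (fun p => k p + (x + 1)) (fun p q hpq => ?_) (fun p => ?_)
      fun p => ⟨?_, Or.inr ho.2⟩
    · have := hk hpq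
      simp only
      omega
    · rw [hg1, hh]
    · omega
  · ext i
    by_cases hi : i ≤ x
    · rw [glue_of_le hi, hf1 i hi]
    · obtain ⟨j, rfl⟩ : ∃ j, i = j + (x + 1) := ⟨i - (x + 1), by omega⟩
      rw [glue_add, hg1]

end glue

theorem ncard_partials_succ_succ {m : ℕ} {σ : Fin m → Fin m} (hconn : ConnectedMatching σ)
    (hσ : ∀ i, σ i ≠ i) (N h : ℕ) :
    (partials σ (N + 1) (h + 1)).ncard = ∑ x ∈ Finset.HasAntidiagonal.antidiagonal N,
      ((partials σ x.1 h).ncard + (partials σ x.1 (h + 2)).ncard) *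
        {f | Block σ x.2 f}.ncard := by
  let W : ℕ → Set (ℕ → ℕ) := fun x => {f ∈ partials σ (x + 1) (h + 1) | Outer f x}
  let V : ℕ × ℕ → Set (ℕ → ℕ) := fun x =>
    (fun q : (ℕ → ℕ) × (ℕ → ℕ) => glue x.1 q.1 q.2) '' (W x.1 ×ˢ {f | Block σ x.2 f})
  have hunion : partials σ (N + 1) (h + 1) = ⋃ x ∈ (Finset.HasAntidiagonal.antidiagonal N : Set (ℕ × ℕ)), V x := by
    ext f
    simp only [Set.mem_iUnion]
    constructor
    · intro hf
      obtain ⟨x, L, hxL, f', hf', ho, g, hg, rfl⟩ := exists_glue_eq hσ hf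
      exact ⟨(x, L), by simpa using hxL, (f', g), ⟨⟨hf', ho⟩, hg⟩, rfl⟩
    · rintro ⟨⟨x, L⟩, hxL, ⟨f', g⟩, ⟨⟨hf', ho⟩, hg⟩, rfl⟩
      have : x + L = N := by simpa using hxL
      rw [← this]
      exact glue_mem_partials hconn hf' hg
  have hfin : ∀ x ∈ (Finset.HasAntidiagonal.antidiagonal N : Set (ℕ × ℕ)), (V x).Finite := by
    intro x _
    exact (((finite_partials σ _ _).subset fun f hf => hf.1).prod (finite_block σ _)).image _
  have hdisj : (Finset.HasAntidiagonal.antidiagonal N : Set (ℕ × ℕ)).PairwiseDisjoint V := by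
    rintro ⟨x, L⟩ hx ⟨y, K⟩ hy hne
    have hx' : x + L = N := by simpa using hx
    have hy' : y + K = N := by simpa using hy
    refine Set.disjoint_left.2 ?_
    rintro f ⟨⟨f₁, g₁⟩, ⟨⟨hf₁, ho₁⟩, hg₁⟩, rfl⟩ ⟨⟨f₂, g₂⟩, ⟨⟨hf₂, ho₂⟩, hg₂⟩, heq⟩
    simp only at heq
    rcases lt_trichotomy x y with hlt | rfl | hlt
    · refine not_outer_glue hf₁ hg₁ hlt (by omega) ?_
      rw [← heq]
      exact outer_glue hf₂ ho₂
    · exact hne (by ext <;> simp; omega)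
    · refine not_outer_glue hf₂ hg₂ hlt (by omega) ?_
      rw [heq]
      exact outer_glue hf₁ ho₁
  rw [hunion, (Finset.finite_toSet _).ncard_biUnion hfin hdisj, finsum_mem_coe_finset]
  refine Finset.sum_congr rfl fun x _ => ?_
  rw [← ncard_partials_outer hσ, ← Set.ncard_prod, Set.InjOn.ncard_image]
  rintro ⟨f₁, g₁⟩ ⟨⟨hf₁, -⟩, -⟩ ⟨f₂, g₂⟩ ⟨⟨hf₂, -⟩, -⟩ heq
  simp only at heq
  refine Prod.ext (funext fun i => ?_) (funext fun i => ?_)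
  · by_cases hi : i ≤ x.1
    · have := congrFun heq i
      rwa [glue_of_le hi, glue_of_le hi] at this
    · exact (hf₁.2.1 i (by omega)).trans (hf₂.2.1 i (by omega)).symm
  · have := congrFun heq (i + (x.1 + 1))
    rw [glue_add, glue_add] at this
    simpa using this

open PowerSeries in
/-- A system of power series determined by its recurrences, with its solution by geometric
sequences. -/
theorem coeff_eq_of_recurrence {R : Type*} [CommRing R] (v : ℕ → ℕ → R) (b : ℕ → R)
    (h00 : v 0 0 = 1) (h0 : ∀ h, v 0 (h + 1) = 0) (hv0 : ∀ N, v (N + 1) 0 = v N 1)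
    (hv : ∀ N h, v (N + 1) (h + 1) =
      ∑ x ∈ Finset.HasAntidiagonal.antidiagonal N, (v x.1 h + v x.1 (h + 2)) * b x.2)
    (A V : PowerSeries R) (hA : A = mk b * (1 + X ^ 2 * A ^ 2)) (hV : V = 1 + X ^ 2 * A * V) :
    ∀ N h, v N h = coeff N ((X * A) ^ h * V) := by
  intro N
  induction N using Nat.strong_induction_on with
  | _ N ih =>
  intro h
  have hstep : ∀ h, (X * A) ^ (h + 1) * V =
      X * (((X * A) ^ h * V + (X * A) ^ (h + 2) * V) * mk b) := by
    intro h
    calc (X * A) ^ (h + 1) * V = X * ((X * A) ^ h * V * A) := by ring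
      _ = X * ((X * A) ^ h * V * (mk b * (1 + X ^ 2 * A ^ 2))) := by rw [← hA]
      _ = _ := by ring
  have hzero : V = 1 + X * ((X * A) ^ 1 * V) := by
    calc V = 1 + X ^ 2 * A * V := hV
      _ = _ := by ring
  cases N with
  | zero =>
    cases h with
    | zero =>
      rw [h00, pow_zero, one_mul, hzero]
      simp
    | succ h =>
      rw [h0, hstep]
      simp
  | succ N =>
    cases h with
    | zero =>
      rw [hv0, pow_zero, one_mul, hzero, map_add, coeff_succ_X_mul, ih N (by omega)]
      simp [coeff_one]
    | succ h =>
      rw [hv, hstep, coeff_succ_X_mul, coeff_mul]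
      refine Finset.sum_congr rfl fun x hx => ?_
      have := Finset.HasAntidiagonal.mem_antidiagonal.1 hx
      rw [ih _ (by omega), ih _ (by omega), map_add, coeff_mk]

theorem natCard_eq_ncard_image {M : ℕ} (P : (Fin M → Fin M) → Prop) :
    Nat.card {f // P f} = (extendNat '' {f | P f}).ncard := by
  rw [Set.ncard_image_of_injective _ (extendNat_injective M)]
  rfl

open PowerSeries in
theorem gf_lifting (s : ℕ) (σ : Fin (2 * s) → Fin (2 * s))
    (hσ : IsMatching σ) (hconn : ConnectedMatching σ)
    (F G D : PowerSeries ℚ)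
    (hF : F = PowerSeries.mk fun n =>
      (Nat.card {f : Fin (2 * n) → Fin (2 * n) //
        IsMatching f ∧ Avoids σ f ∧ Avoids chi f ∧ Avoids chibar f} : ℚ))
    (hG : G = PowerSeries.mk fun n =>
      (Nat.card {f : Fin (2 * n) → Fin (2 * n) //
        IsMatching f ∧ Avoids (liftMatching σ) f ∧ Avoids chi f ∧ Avoids chibar f} : ℚ))
    (hD : D = 1 + (X * F ^ 2) * D ^ 2) :
    G * (1 - X * F * D) = 1 := by
  have hne := hσ.2
  have hB : ∀ n, (PowerSeries.coeff n F : ℚ) = {f | Block σ (2 * n) f}.ncard := by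
    intro n
    rw [hF, coeff_mk, natCard_eq_ncard_image, extendNat_image_eq_block hne]
  have hV : ∀ n, (PowerSeries.coeff n G : ℚ) = (partials σ (2 * n) 0).ncard := by
    intro n
    rw [hG, coeff_mk, natCard_eq_ncard_image, extendNat_image_eq_partials hconn.1 hne]
  have hE : expand 2 two_ne_zero F = mk fun N => ({f | Block σ N f}.ncard : ℚ) := by
    ext N
    rw [coeff_mk]
    by_cases hN : 2 ∣ N
    · obtain ⟨n, rfl⟩ := hN
      rw [coeff_expand_mul, hB]
    · rw [coeff_expand_of_not_dvd _ _ _ hN, ncard_block_of_odd σ hN, Nat.cast_zero]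
  have hinv : (1 - X * F * D)⁻¹ * (1 - X * F * D) = 1 :=
    PowerSeries.inv_mul_cancel _ (by simp)
  set K := (1 - X * F * D)⁻¹
  have hD' : F * D = F * (1 + X * (F * D) ^ 2) := by
    linear_combination F * hD
  have hK : K = 1 + X * (F * D) * K := by
    linear_combination hinv
  have key := coeff_eq_of_recurrence (fun N h => ((partials σ N h).ncard : ℚ))
    (fun N => ({f | Block σ N f}.ncard : ℚ))
    (by simp [ncard_partials_zero_zero hconn.1 hne]) (by simp [ncard_partials_zero_succ])
    (by simp [ncard_partials_succ_zero hne])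
    (by intro N h; simp [ncard_partials_succ_succ hconn hne])
    (expand 2 two_ne_zero (F * D)) (expand 2 two_ne_zero K)
    (by
      rw [← hE]
      simpa using congrArg (expand 2 two_ne_zero) hD')
    (by simpa using congrArg (expand 2 two_ne_zero) hK)
  have hGK : G = K := by
    ext n
    have := key (2 * n) 0
    rw [pow_zero, one_mul, coeff_expand_mul] at this
    rw [hV, ← this]
  rw [hGK, hinv]
end

section
/- For every n ≥ 0, the number of matchings of [2n] avoiding the unlabeled pattern [123132] equals (1/(2n+1))·binom(3n, n), the number of ternary trees with n nodes; moreover there is an explicit bijection between such matchings and ternary trees with n nodes. -/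
def p121323 : Fin 6 → Fin 6 := ![2, 4, 0, 5, 1, 3]
def p123213 : Fin 6 → Fin 6 := ![4, 3, 5, 1, 0, 2]
def p123132 : Fin 6 → Fin 6 := ![3, 5, 4, 0, 2, 1]

inductive TernaryTree : Type
  | leaf : TernaryTree
  | node : TernaryTree → TernaryTree → TernaryTree → TernaryTree

def TernaryTree.size : TernaryTree → ℕ
  | .leaf => 0
  | .node a b c => a.size + b.size + c.size + 1

/-- The three linear forms of the cyclic pattern `[123132]`, stated for functions on `ℕ`. -/
def CrossAvoids (f : ℕ → ℕ) : Prop :=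
  ∀ a b c, a < b →
    ¬ (b < f a ∧ f a < c ∧ c < f b ∧ f b < f c) ∧
    ¬ (b < c ∧ c < f b ∧ f b < f a ∧ f a < f c) ∧
    ¬ (b < c ∧ c < f a ∧ f a < f c ∧ f c < f b)

/-- Avoiding matchings of the first `N` naturals, extended by the identity. -/
def avoidingMatchings (N : ℕ) : Set (ℕ → ℕ) :=
  {f | (∀ i, f (f i) = i) ∧ (∀ i, f i = i ↔ N ≤ i) ∧ CrossAvoids f}

/-- A block of pairwise crossing edges occupying an interval starts at `p`. -/
def IsBlockStart (f : ℕ → ℕ) (p : ℕ) : Prop :=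
  p < f p ∧ ∀ j, p + j < f p → f (p + j) = f p + j

theorem apply_lt_of_mem {N : ℕ} {f : ℕ → ℕ} (hf : f ∈ avoidingMatchings N) {i : ℕ}
    (hi : i < N) : f i < N := by
  by_contra h
  have h1 := (hf.2.1 (f i)).2 (by omega)
  rw [hf.1] at h1
  have := (hf.2.1 i).1 h1.symm
  omega

theorem IsBlockStart.lt {N p : ℕ} {f : ℕ → ℕ} (hf : f ∈ avoidingMatchings N)
    (h : IsBlockStart f p) : f p < N := by
  apply apply_lt_of_mem hf
  by_contra h'
  have := (hf.2.1 p).2 (by omega)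
  have := h.1
  omega

/-- `f` is the shift by half the block length, or its inverse, on the block starting at `p`. -/
theorem IsBlockStart.apply {p x : ℕ} {f : ℕ → ℕ} (hf : ∀ i, f (f i) = i)
    (h : IsBlockStart f p) :
    (p ≤ x → x < f p → f x = x + (f p - p)) ∧
      (f p ≤ x → x < f p + (f p - p) → f x = x - (f p - p)) := by
  obtain ⟨h0, h1⟩ := h
  constructor
  · intro h2 h3
    have := h1 (x - p) (by omega)
    rw [show p + (x - p) = x by omega] at this
    omega
  · intro h2 h3
    have := h1 (x - f p) (by omega)
    rw [show f p + (x - f p) = x by omega] at this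
    rw [← this, hf]
    omega

theorem IsBlockStart.disjoint {p q : ℕ} {f : ℕ → ℕ} (hf : ∀ i, f (f i) = i)
    (hp : IsBlockStart f p) (hq : IsBlockStart f q) (hpq : p < q) :
    f p + (f p - p) ≤ q := by
  by_contra h
  have h1 := hp.apply (x := q) hf
  have h2 := hq.1
  have h3 := hq.2 (f p - q)
  have h4 := hp.1
  by_cases h5 : q < f p
  · have h6 := h1.1 hpq.le h5
    rw [show q + (f p - q) = f p by omega, hf] at h3
    omega
  · have := h1.2 (by omega) (by omega)
    omega

/-- An edge opening at `a` that is not crossed from the left. -/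
def IsLeftFree (f : ℕ → ℕ) (a : ℕ) : Prop :=
  a < f a ∧ ∀ x, a < x → x < f a → a < f x

theorem exists_isBlockStart {N : ℕ} {f : ℕ → ℕ} (hf : f ∈ avoidingMatchings N) (hN : 0 < N) :
    ∃ p, IsBlockStart f p := by
  classical
  obtain ⟨inv, fix, av⟩ := hf
  have hb : ∀ a, IsLeftFree f a → a ≤ N := by
    intro a ha
    by_contra h
    have := (fix a).2 (by omega)
    have := ha.1
    omega
  have hne : ∀ i, i < N → f i ≠ i := fun i hi h => by
    have := (fix i).1 h; omega
  have h0 : IsLeftFree f 0 := by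
    refine ⟨Nat.pos_of_ne_zero (hne 0 hN), fun x hx hx0 => ?_⟩
    rcases Nat.eq_zero_or_pos (f x) with h | h
    · have := inv x
      rw [h] at this
      omega
    · exact h
  obtain ⟨a, ha, hmax⟩ : ∃ a, IsLeftFree f a ∧ ∀ b, IsLeftFree f b → b ≤ a :=
    ⟨Nat.findGreatest (IsLeftFree f) N, Nat.findGreatest_spec (P := IsLeftFree f) (Nat.zero_le N) h0,
      fun b hb' => Nat.le_findGreatest (hb b hb') hb'⟩
  obtain ⟨ha1, ha2⟩ := ha
  have haN : f a < N := by
    by_contra h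
    have h1 := (fix (f a)).2 (by omega)
    rw [inv] at h1
    omega
  have hinj : ∀ x y, f x = f y → x = y := fun x y h => by
    rw [← inv x, h, inv]
  -- no edge is nested below the edge at `a`
  have hin : ∀ x, a < x → x < f a → f a < f x := by
    by_contra! hcon
    obtain ⟨h1, h2, h3⟩ := Nat.find_spec hcon
    have hmin : ∀ y, y < Nat.find hcon → ¬ (a < y ∧ y < f a ∧ f y ≤ f a) :=
      fun y hy => Nat.find_min hcon hy
    generalize Nat.find hcon = x at *
    have h4 : x < f x := by
      have h5 := ha2 x h1 h2
      have h6 := hne x (by omega)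
      by_contra h7
      refine hmin (f x) (by omega) ⟨h5, by omega, ?_⟩
      rw [inv]; omega
    have h5 : IsLeftFree f x := by
      refine ⟨h4, fun y hy1 hy2 => ?_⟩
      by_contra h6
      have h7 := ha2 y (by omega) (by omega)
      have h8 : f y ≠ x := fun h => by rw [← h, inv] at hy2; omega
      refine hmin (f y) (by omega) ⟨h7, by omega, ?_⟩
      rw [inv]; omega
    have := hmax x h5
    omega
  have hmono : ∀ x y, a ≤ x → x < y → y < f a → f x < f y := by
    intro x y hx hxy hy
    rcases Nat.eq_or_lt_of_le hx with rfl | hx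
    · exact hin y hxy hy
    · by_contra h
      have h1 := hin y (by omega) hy
      have h2 : f x ≠ f y := fun h => by have := hinj _ _ h; omega
      exact (av a x y hx).2.2 ⟨hxy, hy, h1, by omega⟩
  -- the partners of the points below the edge at `a` are contiguous
  have hout : ∀ l, a < l → l < f a → ∀ z, f a < z → z < f l → a < f z ∧ f z < f a := by
    intro l hl1 hl2
    have hcase : ∀ z, f a < z → z < f l → ¬ (a < f z ∧ f z < f a) → f a < f z ∧ f z < f l := by
      intro z hz1 hz2 hz3
      have n1 : f z ≠ a := fun h => by rw [← h, inv] at hz1; omega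
      have n2 : f z ≠ f a := fun h => by have := hinj _ _ h; omega
      have n3 : f z ≠ f l := fun h => by have := hinj _ _ h; omega
      have c1 := (av (f z) a l)
      have c2 := (av a l z hl1).1
      rw [inv] at c1
      constructor
      · by_contra h
        have h1 : f z < a := by omega
        exact (c1 h1).2.1 ⟨hl1, hl2, hz1, hz2⟩
      · by_contra h
        exact c2 ⟨hl2, hz1, hz2, by omega⟩
    by_contra! hcon
    have hcon' : ∃ z, f a < z ∧ z < f l ∧ ¬ (a < f z ∧ f z < f a) := by
      obtain ⟨z, h1, h2, h3⟩ := hcon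
      exact ⟨z, h1, h2, fun h => absurd (h3 h.1) (by omega)⟩
    obtain ⟨h1, h2, h3⟩ := Nat.find_spec hcon'
    have hmin : ∀ y, y < Nat.find hcon' → ¬ (f a < y ∧ y < f l ∧ ¬ (a < f y ∧ f y < f a)) :=
      fun y hy => Nat.find_min hcon' hy
    generalize Nat.find hcon' = z at *
    have h4 := hcase z h1 h2 h3
    have hzN : z ≠ f z := fun h => by
      have h5 := (fix z).1 h.symm
      have h6 := (fix (f l)).2 (by omega)
      rw [inv] at h6
      omega
    have h5 : z < f z := by
      by_contra h6
      refine hmin (f z) (by omega) ⟨h4.1, h4.2, ?_⟩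
      rw [inv]; omega
    have h6 : IsLeftFree f z := by
      refine ⟨h5, fun y hy1 hy2 => ?_⟩
      by_contra h6
      have h8 : f y ≠ z := fun h => by rw [← h, inv] at hy2; omega
      by_cases h9 : a < f y ∧ f y < f a
      · have c := (av a (f y) z h9.1).1
        rw [inv] at c
        exact c ⟨h9.2, h1, hy1, hy2⟩
      · have h10 := hcase y (by omega) (by omega) h9
        refine hmin (f y) (by omega) ⟨h10.1, h10.2, ?_⟩
        rw [inv]; omega
    have := hmax z h6
    omega
  refine ⟨a, ha1, fun j => ?_⟩
  induction j with
  | zero => simp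
  | succ j ih =>
    intro hj
    have h1 := ih (by omega)
    have h2 := hmono (a + j) (a + (j + 1)) (by omega) (by omega) hj
    by_contra h3
    have h4 := hout (a + (j + 1)) (by omega) hj (f a + (j + 1)) (by omega) (by omega)
    have h5 := inv (f a + (j + 1))
    rcases Nat.lt_trichotomy (f (f a + (j + 1))) (a + (j + 1)) with h | h | h
    · rcases Nat.eq_or_lt_of_le (show f (f a + (j + 1)) ≤ a + j by omega) with h | h'
      · rw [h] at h5; omega
      · have := hmono _ (a + j) h4.1.le h' (by omega)
        omega
    · rw [h] at h5; omega
    · have := hmono (a + (j + 1)) _ (by omega) h h4.2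
      omega


/-- The number of ordered forests of `k` ternary trees with `m` nodes in total. -/
def forestCount : ℕ → ℕ → ℕ
  | 0, _ => 1
  | _ + 1, 0 => 0
  | m + 1, k + 1 => forestCount (m + 1) k + forestCount m (k + 3)
termination_by m k => (m, k)

theorem forestCount_zero (k : ℕ) : forestCount 0 k = 1 := by rw [forestCount]

theorem forestCount_succ_zero (m : ℕ) : forestCount (m + 1) 0 = 0 := by rw [forestCount]

theorem forestCount_succ_succ (m k : ℕ) :
    forestCount (m + 1) (k + 1) = forestCount (m + 1) k + forestCount m (k + 3) := by
  rw [forestCount]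

theorem forestCount_succ_eq_sum (m k : ℕ) :
    forestCount (m + 1) k = ∑ j ∈ Finset.range k, forestCount m (j + 3) := by
  induction k with
  | zero => simp [forestCount_succ_zero]
  | succ k ih => rw [forestCount_succ_succ, Finset.sum_range_succ, ih]

theorem forestCount_mul (m k : ℕ) :
    forestCount m k * (3 * m + k) = k * (3 * m + k).choose m := by
  induction m generalizing k with
  | zero => simp [forestCount_zero]
  | succ m ihm =>
    induction k with
    | zero => simp [forestCount_succ_zero]
    | succ k ihk =>
      rw [forestCount_succ_succ]
      have h1 := ihm (k + 3)
      have h2 := Nat.choose_succ_right_eq (3 * m + k + 3) m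
      have h3 := Nat.add_one_mul_choose_eq (3 * m + k + 3) m
      rw [show 3 * (m + 1) + k = 3 * m + k + 3 by ring] at ihk
      rw [show 3 * m + (k + 3) = 3 * m + k + 3 by ring] at h1
      rw [show 3 * m + k + 3 - m = 2 * m + k + 3 by omega] at h2
      rw [show 3 * (m + 1) + (k + 1) = 3 * m + k + 3 + 1 by ring]
      generalize forestCount (m + 1) k = x at *
      generalize forestCount m (k + 3) = y at *
      generalize (3 * m + k + 3).choose (m + 1) = c' at *
      generalize (3 * m + k + 3).choose m = c at *
      generalize (3 * m + k + 3 + 1).choose (m + 1) = d at *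
      have h4 : (m + 1) * (x + y) = (k + 1) * c := by
        refine Nat.eq_of_mul_eq_mul_right (show 0 < 3 * m + k + 3 by omega) ?_
        linear_combination (m + 1) * ihk + (m + 1) * h1 + k * h2
      refine Nat.eq_of_mul_eq_mul_left (show 0 < m + 1 by omega) ?_
      linear_combination (3 * m + k + 3 + 1) * h4 + (k + 1) * h3

theorem forestCount_one_mul (n : ℕ) : forestCount n 1 * (2 * n + 1) = (3 * n).choose n := by
  have h1 := forestCount_mul n 1
  have h3 := Nat.choose_mul_succ_eq (3 * n) n
  rw [show 3 * n + 1 - n = 2 * n + 1 by omega] at h3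
  refine Nat.eq_of_mul_eq_mul_right (show 0 < 3 * n + 1 by omega) ?_
  linear_combination (2 * n + 1) * h1 - h3

/-- Forests of `k` ternary trees with `n` nodes in total. -/
abbrev TernaryForest (n k : ℕ) : Type :=
  {l : List TernaryTree // l.length = k ∧ (l.map TernaryTree.size).sum = n}

/-- Splitting a nonempty forest according to its first tree. -/
def ternaryForestEquiv (n k : ℕ) :
    TernaryForest (n + 1) (k + 1) ≃ TernaryForest (n + 1) k ⊕ TernaryForest n (k + 3) where
  toFun
    | ⟨[], h⟩ => absurd h.1 (by simp)
    | ⟨.leaf :: l, h⟩ => .inl ⟨l, by simpa [TernaryTree.size] using h⟩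
    | ⟨.node a b c :: l, h⟩ => .inr ⟨a :: b :: c :: l, by
        simp only [List.length_cons, List.map_cons, List.sum_cons, TernaryTree.size] at h ⊢
        omega⟩
  invFun
    | .inl ⟨l, h⟩ => ⟨.leaf :: l, by simpa [TernaryTree.size] using h⟩
    | .inr ⟨[], h⟩ => absurd h.1 (by simp)
    | .inr ⟨[_], h⟩ => absurd h.1 (by simp)
    | .inr ⟨[_, _], h⟩ => absurd h.1 (by simp)
    | .inr ⟨a :: b :: c :: l, h⟩ => ⟨.node a b c :: l, by
        simp only [List.length_cons, List.map_cons, List.sum_cons, TernaryTree.size] at h ⊢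
        omega⟩
  left_inv := by
    rintro ⟨_ | ⟨_ | ⟨a, b, c⟩, l⟩, h⟩
    · simp at h
    · rfl
    · rfl
  right_inv := by
    rintro (⟨l, h⟩ | ⟨_ | ⟨a, _ | ⟨b, _ | ⟨c, l⟩⟩⟩, h⟩)
    · rfl
    · simp at h
    · simp at h
    · simp at h
    · rfl

theorem TernaryTree.eq_leaf_of_size {t : TernaryTree} (h : t.size = 0) : t = .leaf := by
  cases t with
  | leaf => rfl
  | node a b c => simp [TernaryTree.size] at h

theorem card_ternaryForest (n k : ℕ) :
    Finite (TernaryForest n k) ∧ Nat.card (TernaryForest n k) = forestCount n k := by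
  induction n generalizing k with
  | zero =>
    have : Unique (TernaryForest 0 k) :=
      { default := ⟨List.replicate k .leaf, by simp [TernaryTree.size]⟩
        uniq := fun ⟨l, h1, h2⟩ => Subtype.ext <| List.eq_replicate_iff.2 ⟨h1, fun t ht =>
          TernaryTree.eq_leaf_of_size
            (List.sum_eq_zero_iff.1 h2 _ (List.mem_map_of_mem ht))⟩ }
    exact ⟨inferInstance, by rw [forestCount_zero, Nat.card_unique]⟩
  | succ n ihn =>
    induction k with
    | zero =>
      have : IsEmpty (TernaryForest (n + 1) 0) := ⟨fun ⟨l, h1, h2⟩ => by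
        rw [List.length_eq_zero_iff] at h1
        simp [h1] at h2⟩
      exact ⟨inferInstance, by rw [forestCount_succ_zero, Nat.card_of_isEmpty]⟩
    | succ k ihk =>
      have := ihk.1
      have := (ihn (k + 3)).1
      refine ⟨Finite.of_equiv _ (ternaryForestEquiv n k).symm, ?_⟩
      rw [Nat.card_congr (ternaryForestEquiv n k), Nat.card_sum, ihk.2, (ihn _).2,
        forestCount_succ_succ]

/-- A ternary tree as a forest with one component. -/
def ternaryTreeEquiv (n : ℕ) : {t : TernaryTree // t.size = n} ≃ TernaryForest n 1 where
  toFun t := ⟨[t.1], by simp [t.2]⟩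
  invFun
    | ⟨[], h⟩ => absurd h.1 (by simp)
    | ⟨[t], h⟩ => ⟨t, by simpa using h⟩
    | ⟨_ :: _ :: _, h⟩ => absurd h.1 (by simp)
  left_inv _ := rfl
  right_inv := by
    rintro ⟨_ | ⟨t, _ | ⟨u, l⟩⟩, h⟩
    · simp at h
    · rfl
    · simp at h

theorem sum_range_sum_range_succ_mul (L : ℕ) (a b : ℕ → ℕ) :
    ∑ p ∈ Finset.range L, (∑ q ∈ Finset.range (p + 1), a q) * b (L - p) =
      ∑ q ∈ Finset.range L, a q * ∑ j ∈ Finset.range (L - q), b (j + 1) := by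
  simp only [Finset.sum_mul, Finset.mul_sum]
  rw [Finset.sum_sigma', Finset.sum_sigma']
  refine Finset.sum_bij' (fun x _ => ⟨x.2, L - 1 - x.1⟩) (fun x _ => ⟨L - 1 - x.2, x.1⟩)
    ?_ ?_ ?_ ?_ ?_
  · rintro ⟨p, q⟩ h
    simp only [Finset.mem_sigma, Finset.mem_range] at h ⊢
    omega
  · rintro ⟨p, q⟩ h
    simp only [Finset.mem_sigma, Finset.mem_range] at h ⊢
    omega
  · rintro ⟨p, q⟩ h
    simp only [Finset.mem_sigma, Finset.mem_range] at h
    simp only [Sigma.mk.injEq, heq_eq_eq, and_true]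
    omega
  · rintro ⟨p, q⟩ h
    simp only [Finset.mem_sigma, Finset.mem_range] at h
    simp only [Sigma.mk.injEq, heq_eq_eq, true_and]
    omega
  · rintro ⟨p, q⟩ h
    simp only [Finset.mem_sigma, Finset.mem_range] at h
    rw [show L - 1 - p + 1 = L - p by omega]

/-- The increasing enumeration of `ℕ` without `p` and `q`. -/
def skip (p q i : ℕ) : ℕ := if i < p then i else if i + 1 < q then i + 1 else i + 2

/-- The left inverse of `skip p q`. -/
def unskip (p q i : ℕ) : ℕ := if i < p then i else if i < q then i - 1 else i - 2

/-- Insert an edge whose endpoints become `p` and `q`. -/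
def insertEdge (p q : ℕ) (f : ℕ → ℕ) : ℕ → ℕ := fun i =>
  if i = p then q else if i = q then p else skip p q (f (unskip p q i))

/-- Delete the edge with endpoints `p` and `q`. -/
def deleteEdge (p q : ℕ) (f : ℕ → ℕ) : ℕ → ℕ := fun i => unskip p q (f (skip p q i))

section

variable {p q : ℕ}

theorem skip_lt_skip {i j : ℕ} : skip p q i < skip p q j ↔ i < j := by
  unfold skip; split_ifs <;> omega

theorem skip_ne_left (i : ℕ) : skip p q i ≠ p := by
  unfold skip; split_ifs <;> omega

theorem skip_ne_right (h : p < q) (i : ℕ) : skip p q i ≠ q := by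
  unfold skip; split_ifs <;> omega

theorem unskip_skip (i : ℕ) : unskip p q (skip p q i) = i := by
  unfold skip unskip; split_ifs <;> omega

theorem skip_unskip (h : p < q) {i : ℕ} (hp : i ≠ p) (hq : i ≠ q) :
    skip p q (unskip p q i) = i := by
  unfold skip unskip; split_ifs <;> omega

theorem insertEdge_left (f : ℕ → ℕ) : insertEdge p q f p = q := by
  simp [insertEdge]

theorem insertEdge_right (h : p < q) (f : ℕ → ℕ) : insertEdge p q f q = p := by
  simp [insertEdge, h.ne']

theorem insertEdge_skip (h : p < q) (f : ℕ → ℕ) (i : ℕ) :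
    insertEdge p q f (skip p q i) = skip p q (f i) := by
  simp [insertEdge, skip_ne_left, skip_ne_right h, unskip_skip]

theorem deleteEdge_insertEdge (h : p < q) (f : ℕ → ℕ) :
    deleteEdge p q (insertEdge p q f) = f := by
  funext i
  simp [deleteEdge, insertEdge_skip h, unskip_skip]

theorem skip_deleteEdge (h : p < q) {f : ℕ → ℕ} (hf : ∀ i, f (f i) = i) (hp : f p = q) (i : ℕ) :
    skip p q (deleteEdge p q f i) = f (skip p q i) := by
  refine skip_unskip h (fun h1 => ?_) (fun h1 => ?_)
  · have h2 := hf (skip p q i)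
    rw [h1, hp] at h2
    exact skip_ne_right h i h2.symm
  · have h2 := hf (skip p q i)
    rw [h1, ← hp, hf] at h2
    exact skip_ne_left i h2.symm

theorem insertEdge_deleteEdge (h : p < q) {f : ℕ → ℕ} (hf : ∀ i, f (f i) = i) (hp : f p = q) :
    insertEdge p q (deleteEdge p q f) = f := by
  funext i
  by_cases h1 : i = p
  · rw [h1, insertEdge_left, hp]
  by_cases h2 : i = q
  · rw [h2, insertEdge_right h, ← hp, hf]
  rw [← skip_unskip h h1 h2, insertEdge_skip h, skip_deleteEdge h hf hp]

theorem deleteEdge_mem {N : ℕ} {f : ℕ → ℕ} (h : p < q) (hf : f ∈ avoidingMatchings (N + 2))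
    (hp : f p = q) : deleteEdge p q f ∈ avoidingMatchings N := by
  obtain ⟨inv, fix, av⟩ := hf
  have hs := skip_deleteEdge h inv hp
  have hinj : ∀ i j, skip p q i = skip p q j → i = j := fun i j hij => by
    rw [← unskip_skip (p := p) (q := q) i, hij, unskip_skip]
  have hq : q < N + 2 := by
    by_contra h1
    have h2 := (fix q).2 (by omega)
    rw [← hp, inv] at h2
    omega
  refine ⟨fun i => hinj _ _ (by rw [hs, hs, inv]), fun i => ?_, fun a b c hab => ?_⟩
  · have h1 : deleteEdge p q f i = i ↔ f (skip p q i) = skip p q i := by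
      rw [← hs]
      exact ⟨fun h2 => by rw [h2], hinj _ _⟩
    rw [h1, fix]
    unfold skip
    split_ifs <;> omega
  · have := av _ (skip p q b) (skip p q c) (skip_lt_skip.2 hab)
    simpa only [← hs, skip_lt_skip] using this

theorem insertEdge_mem {N : ℕ} {f : ℕ → ℕ} (h : p < q) (hf : f ∈ avoidingMatchings N)
    (hq : q < N + 2) (hb : IsBlockStart (insertEdge p q f) p) :
    insertEdge p q f ∈ avoidingMatchings (N + 2) := by
  obtain ⟨inv, fix, av⟩ := hf
  have hs := insertEdge_skip h f
  have hl := insertEdge_left (p := p) (q := q) f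
  have hr := insertEdge_right h f
  have inv' : ∀ i, insertEdge p q f (insertEdge p q f i) = i := fun i => by
    by_cases h1 : i = p
    · rw [h1, hl, hr]
    by_cases h2 : i = q
    · rw [h2, hr, hl]
    rw [← skip_unskip h h1 h2, hs, hs, inv]
  refine ⟨inv', fun i => ?_, fun a b c hab => ?_⟩
  · by_cases h1 : i = p
    · rw [h1, hl]; omega
    by_cases h2 : i = q
    · rw [h2, hr]; omega
    have h3 : insertEdge p q f i = i ↔ f (unskip p q i) = unskip p q i := by
      rw [← skip_unskip h h1 h2, hs, unskip_skip]
      exact ⟨fun h3 => by rw [← unskip_skip (p := p) (q := q) (f _), h3, unskip_skip], fun h3 => by rw [h3]⟩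
    rw [h3, fix]
    unfold unskip
    split_ifs <;> omega
  · by_cases hmem : ∀ x ∈ [a, b, c], x ≠ p ∧ x ≠ q
    · simp only [List.mem_cons, List.not_mem_nil, or_false, forall_eq_or_imp, forall_eq] at hmem
      obtain ⟨ha, hb, hc⟩ := hmem
      have h1 := av (unskip p q a) (unskip p q b) (unskip p q c)
      rw [← skip_unskip h ha.1 ha.2, ← skip_unskip h hb.1 hb.2, skip_lt_skip] at hab
      have h2 := h1 hab
      rw [← skip_unskip h ha.1 ha.2, ← skip_unskip h hb.1 hb.2, ← skip_unskip h hc.1 hc.2]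
      simpa only [hs, skip_lt_skip] using h2
    · have hA := hb.apply (x := a) inv'
      have hB := hb.apply (x := b) inv'
      have hC := hb.apply (x := c) inv'
      have hA' := hb.apply (x := insertEdge p q f a) inv'
      have hB' := hb.apply (x := insertEdge p q f b) inv'
      have hC' := hb.apply (x := insertEdge p q f c) inv'
      rw [inv', hl] at hA' hB' hC'
      rw [hl] at hA hB hC
      have hmem' : (a = p ∨ a = q) ∨ (b = p ∨ b = q) ∨ (c = p ∨ c = q) := by
        by_contra h'
        push Not at h'
        exact hmem (by simpa using h')
      generalize insertEdge p q f a = a' at *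
      generalize insertEdge p q f b = b' at *
      generalize insertEdge p q f c = c' at *
      clear hs hl hr inv' hb inv av fix hmem
      refine ⟨?_, ?_, ?_⟩ <;> omega

/-- Extending a block by one edge. -/
theorem isBlockStart_insertEdge_iff (h : p + 1 < q) (f : ℕ → ℕ) :
    IsBlockStart (insertEdge p q f) p ↔ IsBlockStart f p ∧ f p + 1 = q := by
  have hs := insertEdge_skip (show p < q by omega) f
  unfold IsBlockStart
  rw [insertEdge_left]
  constructor
  · rintro ⟨-, h2⟩
    have key : ∀ j, p + j + 1 < q → f (p + j) = q - 1 + j := by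
      intro j hj
      have h3 := h2 (j + 1) (by omega)
      rw [show p + (j + 1) = skip p q (p + j) by unfold skip; split_ifs <;> omega, hs] at h3
      unfold skip at h3
      split_ifs at h3 <;> omega
    have h0 := key 0 (by omega)
    rw [add_zero] at h0
    exact ⟨⟨by omega, fun j hj => by rw [key j (by omega)]; omega⟩, by omega⟩
  · rintro ⟨⟨h1, h2⟩, h3⟩
    refine ⟨by omega, fun j hj => ?_⟩
    cases j with
    | zero => exact insertEdge_left f
    | succ j =>
      have h4 := h2 j (by omega)
      rw [show p + (j + 1) = skip p q (p + j) by unfold skip; split_ifs <;> omega, hs, h4]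
      unfold skip
      split_ifs <;> omega

/-- Blocks to the right of an inserted edge are translated. -/
theorem isBlockStart_insertEdge_add_two (h : p < q) (f : ℕ → ℕ) {x : ℕ} (hx : q ≤ x + 1) :
    IsBlockStart (insertEdge p q f) (x + 2) ↔ IsBlockStart f x := by
  have hs := insertEdge_skip h f
  have hsk : ∀ y, q ≤ y + 1 → skip p q y = y + 2 := fun y hy => by
    unfold skip; split_ifs <;> omega
  have hk : ∀ y z, q ≤ z + 1 → (skip p q y = z + 2 ↔ y = z) := fun y z hz => by
    unfold skip; split_ifs <;> omega
  have hfx : insertEdge p q f (x + 2) = skip p q (f x) := by rw [← hs, hsk x hx]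
  unfold IsBlockStart
  rw [hfx]
  have h1 : x + 2 < skip p q (f x) ↔ x < f x := by
    rw [← hsk x hx, skip_lt_skip]
  rw [h1]
  refine and_congr_right fun h2 => ?_
  rw [hsk (f x) (by omega)]
  refine forall_congr' fun j => ?_
  rw [show x + 2 + j = x + j + 2 by ring, ← hsk (x + j) (by omega), hs,
    show f x + 2 + j = f x + j + 2 by ring, hk _ _ (by omega), hsk (x + j) (by omega)]
  simp

end

/-- The largest start of a block, or `0` if there is none. -/
noncomputable def lastBlock (f : ℕ → ℕ) : ℕ := sSup {p | IsBlockStart f p}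

theorem bddAbove_isBlockStart {N : ℕ} {f : ℕ → ℕ} (hf : f ∈ avoidingMatchings N) :
    BddAbove {p | IsBlockStart f p} :=
  ⟨N, fun p hp => by have := hp.lt hf; have := hp.1; omega⟩

theorem lastBlock_le_iff {N p : ℕ} {f : ℕ → ℕ} (hf : f ∈ avoidingMatchings N) :
    lastBlock f ≤ p ↔ ∀ x, IsBlockStart f x → x ≤ p :=
  csSup_le_iff' (bddAbove_isBlockStart hf)

theorem lastBlock_le {N : ℕ} {f : ℕ → ℕ} (hf : f ∈ avoidingMatchings N) : lastBlock f ≤ N :=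
  (lastBlock_le_iff hf).2 fun p hp => by have := hp.lt hf; have := hp.1; omega

theorem isBlockStart_lastBlock {N : ℕ} {f : ℕ → ℕ} (hf : f ∈ avoidingMatchings N) (hN : 0 < N) :
    IsBlockStart f (lastBlock f) :=
  Nat.sSup_mem (exists_isBlockStart hf hN) (bddAbove_isBlockStart hf)

open Classical in
/-- The right endpoint of the edge that is inserted at `p`: it extends the block starting at `p`
if there is one, and otherwise joins two adjacent points. -/
noncomputable def newEnd (p : ℕ) (f : ℕ → ℕ) : ℕ := if IsBlockStart f p then f p + 1 else p + 1

theorem lt_newEnd (p : ℕ) (f : ℕ → ℕ) : p < newEnd p f := by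
  unfold newEnd
  split_ifs with h
  · have := h.1; omega
  · omega

theorem isBlockStart_insertEdge_newEnd (p : ℕ) (f : ℕ → ℕ) :
    IsBlockStart (insertEdge p (newEnd p f) f) p := by
  unfold newEnd
  split_ifs with h
  · exact (isBlockStart_insertEdge_iff (by have := h.1; omega) f).2 ⟨h, rfl⟩
  · refine ⟨by rw [insertEdge_left]; omega, fun j hj => ?_⟩
    rw [insertEdge_left] at hj ⊢
    obtain rfl : j = 0 := by omega
    exact insertEdge_left f

theorem newEnd_lt {N p : ℕ} {f : ℕ → ℕ} (hf : f ∈ avoidingMatchings N) (hp : p ≤ N) :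
    newEnd p f < N + 2 := by
  unfold newEnd
  split_ifs with h
  · have := h.lt hf; omega
  · omega

theorem mapsTo_insertEdge {N p : ℕ} (hp : p ≤ N) :
    Set.MapsTo (fun f => insertEdge p (newEnd p f) f)
      {f ∈ avoidingMatchings N | lastBlock f ≤ p}
      {f ∈ avoidingMatchings (N + 2) | lastBlock f = p} := by
  rintro f ⟨hf, hl⟩
  have hb := isBlockStart_insertEdge_newEnd p f
  have hlt := lt_newEnd p f
  have hm := insertEdge_mem hlt hf (newEnd_lt hf hp) hb
  refine ⟨hm, le_antisymm ((lastBlock_le_iff hm).2 fun x hx => ?_)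
    (le_csSup (bddAbove_isBlockStart hm) hb)⟩
  by_contra! h
  have h1 := hb.disjoint hm.1 hx h
  rw [insertEdge_left] at h1
  obtain ⟨y, rfl⟩ : ∃ y, x = y + 2 := ⟨x - 2, by omega⟩
  rw [isBlockStart_insertEdge_add_two hlt f (by omega)] at hx
  have h2 := (lastBlock_le_iff hf).1 hl y hx
  obtain rfl : y = p := by omega
  have h3 := hx.1
  rw [newEnd, if_pos hx] at h1
  omega

theorem newEnd_deleteEdge {N p : ℕ} {f : ℕ → ℕ} (hf : f ∈ avoidingMatchings (N + 2))
    (hl : lastBlock f = p) : newEnd p (deleteEdge p (f p) f) = f p := by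
  have hb := isBlockStart_lastBlock hf (by omega)
  rw [hl] at hb
  have hlt := hb.1
  have hi := insertEdge_deleteEdge hlt hf.1 rfl
  generalize hg : deleteEdge p (f p) f = g at hi ⊢
  by_cases h : p + 1 < f p
  · rw [← hi, isBlockStart_insertEdge_iff h] at hb
    rw [newEnd, if_pos hb.1, hb.2]
  · rw [newEnd, if_neg]
    · omega
    · intro h1
      rw [← isBlockStart_insertEdge_add_two hlt g (by omega), hi] at h1
      have := (lastBlock_le_iff hf).1 hl.le _ h1
      omega

theorem mapsTo_deleteEdge {N p : ℕ} :
    Set.MapsTo (fun f => deleteEdge p (f p) f)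
      {f ∈ avoidingMatchings (N + 2) | lastBlock f = p}
      {f ∈ avoidingMatchings N | lastBlock f ≤ p} := by
  rintro f ⟨hf, hl⟩
  have hb := isBlockStart_lastBlock hf (by omega)
  rw [hl] at hb
  have hlt := hb.1
  have hi := insertEdge_deleteEdge hlt hf.1 rfl
  have hm := deleteEdge_mem hlt hf rfl
  refine ⟨hm, (lastBlock_le_iff hm).2 fun x hx => ?_⟩
  generalize deleteEdge p (f p) f = g at *
  by_contra! h
  have h1 : f p ≤ x + 1 := by
    by_cases h : p + 1 < f p
    · rw [← hi, isBlockStart_insertEdge_iff h] at hb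
      have := hb.1.disjoint hm.1 hx (by omega)
      omega
    · omega
  rw [← isBlockStart_insertEdge_add_two hlt g h1, hi] at hx
  have := (lastBlock_le_iff hf).1 hl.le _ hx
  omega

theorem ncard_lastBlock_eq {N p : ℕ} (hp : p ≤ N) :
    {f ∈ avoidingMatchings (N + 2) | lastBlock f = p}.ncard =
      {f ∈ avoidingMatchings N | lastBlock f ≤ p}.ncard := by
  have hinv : Set.InvOn (fun f => deleteEdge p (f p) f) (fun f => insertEdge p (newEnd p f) f)
      {f ∈ avoidingMatchings N | lastBlock f ≤ p}
      {f ∈ avoidingMatchings (N + 2) | lastBlock f = p} := by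
    constructor
    · rintro f -
      simp only [insertEdge_left]
      exact deleteEdge_insertEdge (lt_newEnd p f) f
    · rintro f ⟨hf, hl⟩
      have hb := isBlockStart_lastBlock hf (by omega)
      rw [hl] at hb
      simp only [newEnd_deleteEdge hf hl]
      exact insertEdge_deleteEdge hb.1 hf.1 rfl
  exact (hinv.bijOn (mapsTo_insertEdge hp) mapsTo_deleteEdge).ncard_eq.symm

theorem occurs_p121323_iff {M : ℕ} {f : Fin M → Fin M} (hf : Function.Involutive f) :
    Occurs p121323 f ↔ ∃ a b c, a < b ∧ b < f a ∧ f a < c ∧ c < f b ∧ f b < f c := by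
  constructor
  · rintro ⟨g, hg, h⟩
    refine ⟨g 0, g 1, g 3, ?_⟩
    rw [h 0, h 1, h 3]
    simp only [hg.lt_iff_lt]
    decide
  · rintro ⟨a, b, c, h1, h2, h3, h4, h5⟩
    refine ⟨![a, b, f a, c, f b, f c], ?_, ?_⟩
    · rw [Fin.strictMono_iff_lt_succ]
      simp [Fin.forall_fin_succ, *]
    · simp [Fin.forall_fin_succ, p121323, hf _]

theorem occurs_p123213_iff {M : ℕ} {f : Fin M → Fin M} (hf : Function.Involutive f) :
    Occurs p123213 f ↔ ∃ a b c, a < b ∧ b < c ∧ c < f b ∧ f b < f a ∧ f a < f c := by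
  constructor
  · rintro ⟨g, hg, h⟩
    refine ⟨g 0, g 1, g 2, ?_⟩
    rw [h 0, h 1, h 2]
    simp only [hg.lt_iff_lt]
    decide
  · rintro ⟨a, b, c, h1, h2, h3, h4, h5⟩
    refine ⟨![a, b, c, f b, f a, f c], ?_, ?_⟩
    · rw [Fin.strictMono_iff_lt_succ]
      simp [Fin.forall_fin_succ, *]
    · simp [Fin.forall_fin_succ, p123213, hf _]

theorem occurs_p123132_iff {M : ℕ} {f : Fin M → Fin M} (hf : Function.Involutive f) :
    Occurs p123132 f ↔ ∃ a b c, a < b ∧ b < c ∧ c < f a ∧ f a < f c ∧ f c < f b := by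
  constructor
  · rintro ⟨g, hg, h⟩
    refine ⟨g 0, g 1, g 2, ?_⟩
    rw [h 0, h 1, h 2]
    simp only [hg.lt_iff_lt]
    decide
  · rintro ⟨a, b, c, h1, h2, h3, h4, h5⟩
    refine ⟨![a, b, c, f a, f c, f b], ?_, ?_⟩
    · rw [Fin.strictMono_iff_lt_succ]
      simp [Fin.forall_fin_succ, *]
    · simp [Fin.forall_fin_succ, p123132, hf _]

/-- Extend a self-map of `Fin M` to `ℕ` by the identity. -/
def extendFin {M : ℕ} (f : Fin M → Fin M) (i : ℕ) : ℕ := if h : i < M then f ⟨i, h⟩ else i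

theorem extendFin_val {M : ℕ} (f : Fin M → Fin M) (i : Fin M) : extendFin f i = f i := by
  simp [extendFin]

theorem extendFin_of_le {M : ℕ} (f : Fin M → Fin M) {i : ℕ} (hi : M ≤ i) :
    extendFin f i = i := by
  simp [extendFin, Nat.not_lt.2 hi]

theorem extendFin_mem_iff {M : ℕ} (f : Fin M → Fin M) :
    extendFin f ∈ avoidingMatchings M ↔
      IsMatching f ∧ Avoids p121323 f ∧ Avoids p123213 f ∧ Avoids p123132 f := by
  have hv := extendFin_val f
  have hle := fun i => extendFin_of_le f (i := i)
  have h1 : (∀ i, extendFin f (extendFin f i) = i) ↔ Function.Involutive f := by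
    constructor
    · intro h i
      have := h i
      rw [hv, hv] at this
      exact Fin.ext this
    · intro h i
      by_cases hi : i < M
      · lift i to Fin M using hi
        rw [hv, hv, h]
      · rw [hle i (by omega), hle i (by omega)]
  have h2 : (∀ i, extendFin f i = i ↔ M ≤ i) ↔ ∀ i, f i ≠ i := by
    constructor
    · intro h i hi
      have := (h i).1 (by rw [hv, hi])
      omega
    · intro h i
      refine ⟨fun h3 => ?_, hle i⟩
      by_contra! hi
      lift i to Fin M using hi
      exact h i (Fin.ext (by rw [← hv, h3]))
  unfold avoidingMatchings IsMatching
  rw [Set.mem_ofPred_eq, h1, h2, and_assoc]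
  refine and_congr_right fun inv => and_congr_right fun _ => ?_
  unfold Avoids
  rw [occurs_p121323_iff inv, occurs_p123213_iff inv, occurs_p123132_iff inv]
  constructor
  · intro h
    refine ⟨?_, ?_, ?_⟩ <;> rintro ⟨a, b, c, h3, h4⟩ <;> have h5 := h a b c h3 <;>
      rw [hv, hv, hv] at h5
    · exact h5.1 h4
    · exact h5.2.1 h4
    · exact h5.2.2 h4
  · rintro ⟨h3, h4, h5⟩ a b c hab
    by_cases h : a < M ∧ b < M ∧ c < M
    · obtain ⟨ha, hb, hc⟩ := h
      lift a to Fin M using ha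
      lift b to Fin M using hb
      lift c to Fin M using hc
      rw [hv, hv, hv]
      exact ⟨fun h => h3 ⟨a, b, c, hab, h⟩, fun h => h4 ⟨a, b, c, hab, h⟩,
        fun h => h5 ⟨a, b, c, hab, h⟩⟩
    · have ha := hle a
      have hb := hle b
      have hc := hle c
      have hlt : ∀ i, i < M → extendFin f i < M := fun i hi => by
        lift i to Fin M using hi
        rw [hv]; exact (f i).2
      have ha' := hlt a
      have hb' := hlt b
      have hc' := hlt c
      refine ⟨?_, ?_, ?_⟩ <;> omega

/-- Matchings on `Fin M` avoiding the three patterns, as functions on `ℕ`. -/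
def avoidingEquiv (M : ℕ) :
    {f : Fin M → Fin M //
      IsMatching f ∧ Avoids p121323 f ∧ Avoids p123213 f ∧ Avoids p123132 f} ≃
      avoidingMatchings M where
  toFun f := ⟨extendFin f.1, (extendFin_mem_iff f.1).2 f.2⟩
  invFun g := ⟨fun i => ⟨g.1 i, apply_lt_of_mem g.2 i.2⟩, (extendFin_mem_iff _).1 <| by
    convert g.2 using 1
    funext i
    by_cases hi : i < M
    · simp [extendFin, hi]
    · rw [extendFin_of_le _ (by omega), (g.2.2.1 i).2 (by omega)]⟩
  left_inv f := by
    ext i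
    simp [extendFin_val]
  right_inv g := by
    ext i
    by_cases hi : i < M
    · simp [extendFin, hi]
    · simp only
      rw [extendFin_of_le _ (by omega), (g.2.2.1 i).2 (by omega)]

theorem finite_avoidingMatchings (N : ℕ) : (avoidingMatchings N).Finite :=
  Set.finite_coe_iff.1 (Finite.of_equiv _ (avoidingEquiv N))

theorem ncard_lastBlock_le (N p : ℕ) :
    {f ∈ avoidingMatchings N | lastBlock f ≤ p}.ncard =
      ∑ q ∈ Finset.range (p + 1), {f ∈ avoidingMatchings N | lastBlock f = q}.ncard := by
  induction p with
  | zero => simp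
  | succ p ih =>
    rw [Finset.sum_range_succ, ← ih, ← Set.ncard_union_eq _
      ((finite_avoidingMatchings N).subset (Set.sep_subset _ _))
      ((finite_avoidingMatchings N).subset (Set.sep_subset _ _))]
    · congr 1
      ext f
      simp only [Set.mem_ofPred_eq, Set.mem_union]
      rw [← and_or_left, Nat.le_succ_iff]
    · rw [Set.disjoint_left]
      rintro f ⟨-, h1⟩ ⟨-, h2⟩
      omega

theorem ncard_avoidingMatchings (N : ℕ) :
    (avoidingMatchings N).ncard =
      ∑ q ∈ Finset.range (N + 1), {f ∈ avoidingMatchings N | lastBlock f = q}.ncard := by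
  rw [← ncard_lastBlock_le]
  congr 1
  ext f
  exact ⟨fun h => ⟨h, lastBlock_le h⟩, fun h => h.1⟩

theorem ncard_lastBlock_of_lt {N p : ℕ} (hp : N < p) :
    {f ∈ avoidingMatchings (N + 2) | lastBlock f = p}.ncard = 0 := by
  rw [Set.ncard_eq_zero ((finite_avoidingMatchings _).subset (Set.sep_subset _ _)),
    Set.eq_empty_iff_forall_notMem]
  rintro f ⟨hf, hl⟩
  have hb := isBlockStart_lastBlock hf (by omega)
  have h1 := hb.lt hf
  have h2 := hb.1
  omega

theorem avoidingMatchings_zero : avoidingMatchings 0 = {id} := by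
  ext f
  rw [Set.mem_singleton_iff]
  constructor
  · rintro ⟨-, h, -⟩
    funext i
    exact (h i).2 (Nat.zero_le i)
  · rintro rfl
    refine ⟨fun _ => rfl, fun i => by simp, fun a b c h => ?_⟩
    simp only [id]
    omega

theorem sum_ncard_mul_forestCount_succ (n m : ℕ) :
    ∑ p ∈ Finset.range (2 * (n + 1) + 1),
        {f ∈ avoidingMatchings (2 * (n + 1)) | lastBlock f = p}.ncard *
          forestCount m (2 * (n + 1) + 1 - p) =
      ∑ p ∈ Finset.range (2 * n + 1),
        {f ∈ avoidingMatchings (2 * n) | lastBlock f = p}.ncard *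
          forestCount (m + 1) (2 * n + 1 - p) := by
  rw [show 2 * (n + 1) = 2 * n + 2 by ring, Finset.sum_range_succ, Finset.sum_range_succ,
    ncard_lastBlock_of_lt (by omega), ncard_lastBlock_of_lt (by omega)]
  simp only [forestCount_succ_eq_sum, zero_mul, add_zero]
  rw [← sum_range_sum_range_succ_mul (2 * n + 1) _ (fun j => forestCount m (j + 2))]
  refine Finset.sum_congr rfl fun p hp => ?_
  rw [Finset.mem_range] at hp
  rw [ncard_lastBlock_eq (by omega), ncard_lastBlock_le,
    show 2 * n + 2 + 1 - p = 2 * n + 1 - p + 2 by omega]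

theorem sum_ncard_mul_forestCount (n m : ℕ) :
    ∑ p ∈ Finset.range (2 * n + 1),
        {f ∈ avoidingMatchings (2 * n) | lastBlock f = p}.ncard *
          forestCount m (2 * n + 1 - p) = forestCount (n + m) 1 := by
  induction n generalizing m with
  | zero =>
    have := ncard_avoidingMatchings 0
    rw [zero_add, Finset.sum_range_one] at this
    rw [mul_zero, zero_add, Finset.sum_range_one, ← this, avoidingMatchings_zero,
      Set.ncard_singleton, one_mul, zero_add]
  | succ n ih => rw [sum_ncard_mul_forestCount_succ, ih, add_right_comm, add_assoc]

theorem ncard_avoidingMatchings_two_mul (n : ℕ) :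
    (avoidingMatchings (2 * n)).ncard = forestCount n 1 := by
  rw [ncard_avoidingMatchings]
  simpa [forestCount_zero] using sum_ncard_mul_forestCount n 0

theorem card_avoid_unlabeled_123132 (n : ℕ) :
    Nat.card {f : Fin (2 * n) → Fin (2 * n) //
        IsMatching f ∧ Avoids p121323 f ∧ Avoids p123213 f ∧ Avoids p123132 f} *
      (2 * n + 1) = Nat.choose (3 * n) n ∧
    Nonempty
      ({f : Fin (2 * n) → Fin (2 * n) //
          IsMatching f ∧ Avoids p121323 f ∧ Avoids p123213 f ∧ Avoids p123132 f} ≃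
        {t : TernaryTree // t.size = n}) := by
  have hcard : Nat.card {f : Fin (2 * n) → Fin (2 * n) //
      IsMatching f ∧ Avoids p121323 f ∧ Avoids p123213 f ∧ Avoids p123132 f} =
      forestCount n 1 := by
    rw [Nat.card_congr (avoidingEquiv (2 * n)), Nat.card_coe_set_eq,
      ncard_avoidingMatchings_two_mul]
  refine ⟨by rw [hcard, forestCount_one_mul], ?_⟩
  obtain ⟨hfin, hforest⟩ := card_ternaryForest n 1
  have : Finite {t : TernaryTree // t.size = n} := Finite.of_equiv _ (ternaryTreeEquiv n).symm
  have := Finite.of_equiv _ (avoidingEquiv (2 * n)).symm (h := finite_avoidingMatchings (2 * n))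
  rw [← Finite.card_eq, hcard, Nat.card_congr (ternaryTreeEquiv n), hforest]
end
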